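/- arXiv:1901.10432 — 3 statements merged into one kernel-verified Lean document; each statement's English description precedes it below -/
import Mathlib

section
/- Let X₁ ⊆ A₁^{ℤ²} and X₂ ⊆ A₂^{ℤ²} be ℤ²-subshifts that are polygonal with respect to integer polygons P₁ and P₂ respectively. Then the product subshift X₁ × X₂ ⊆ (A₁ × A₂)^{ℤ²} — the set of all y such that the first-coordinate projection of y lies in X₁ and the second-coordinate projection lies in X₂ — is polygonal with respect to some integer polygon. -/
namespace PolygonalShifts

abbrev Z2 : Type := ℤ × ℤ

abbrev Config (A : Type*) : Type _ := Z2 → A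

/-- The translation action of `ℤ²` on configurations. -/
def shiftAct {A : Type*} (u : Z2) (x : Config A) : Config A := fun w => x (u + w)

/-- A `ℤ²`-subshift: a closed (for the product topology, with the alphabet discrete)
and translation-invariant set of configurations. -/
def IsSubshift {A : Type*} (X : Set (Config A)) : Prop :=
  (letI : TopologicalSpace A := ⊥
   IsClosed X) ∧
  ∀ u : Z2, ∀ x ∈ X, shiftAct u x ∈ X

/-- The canonical embedding `ℤ² → ℝ²`. -/
def toR2 (p : Z2) : ℝ × ℝ := ((p.1 : ℝ), (p.2 : ℝ))

/-- `S` X-codes `S'`, for subsets `S, S'` of `ℝ²`. -/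
def Codes {A : Type*} (X : Set (Config A)) (S S' : Set (ℝ × ℝ)) : Prop :=
  ∀ x ∈ X, ∀ x' ∈ X,
    (∀ p : Z2, toR2 p ∈ S → x p = x' p) →
    ∀ p : Z2, toR2 p ∈ S' → x p = x' p

/-- `S` X-codes `S'`, for subsets `S, S'` of `ℤ²`. -/
def CodesZ {A : Type*} (X : Set (Config A)) (S S' : Set Z2) : Prop :=
  ∀ x ∈ X, ∀ x' ∈ X, (∀ p ∈ S, x p = x' p) → ∀ p ∈ S', x p = x' p

/-- `Y` is a recoding of `X` via the finite set `F ⊆ ℤ²`. -/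
def IsRecodingVia {A A' : Type*} (X : Set (Config A)) (Y : Set (Config A'))
    (F : Set Z2) : Prop :=
  letI : TopologicalSpace A := ⊥
  letI : TopologicalSpace A' := ⊥
  ∃ Ψ : X ≃ₜ Y,
    (∀ (u : Z2) (x x' : X), (x' : Config A) = shiftAct u (x : Config A) →
      (↑(Ψ x') : Config A') = shiftAct u (↑(Ψ x) : Config A')) ∧
    (∀ (u : Z2) (x x' : X),
      (↑(Ψ x) : Config A') u = (↑(Ψ x') : Config A') u ↔
        ∀ f ∈ F, (x : Config A) (f + u) = (x' : Config A) (f + u))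

/-- `Y` is a recoding of `X`. -/
def IsRecoding {A A' : Type*} (X : Set (Config A)) (Y : Set (Config A')) : Prop :=
  ∃ F : Set Z2, F.Finite ∧ IsRecodingVia X Y F

/-- Integer cross product. -/
def crossZ (u v : Z2) : ℤ := u.1 * v.2 - u.2 * v.1

/-- Real cross product. -/
def crossR (u v : ℝ × ℝ) : ℝ := u.1 * v.2 - u.2 * v.1

/-- A convex integer polygon, given by its (at least three) vertices listed in
counterclockwise order: every vertex lies strictly to the left of every directed edge. -/
structure IntPolygon where
  n : ℕ
  vert : Fin (n + 3) → Z2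
  convex : ∀ i j : Fin (n + 3), j ≠ i → j ≠ i + 1 →
    0 < crossZ (vert (i + 1) - vert i) (vert j - vert i)

namespace IntPolygon

/-- The oriented edge vector from vertex `i` to vertex `i+1`. -/
def edgeVec (P : IntPolygon) (i : Fin (P.n + 3)) : Z2 := P.vert (i + 1) - P.vert i

/-- The polygon as a subset of `ℝ²` (the convex hull of its vertices). -/
def carrier (P : IntPolygon) : Set (ℝ × ℝ) :=
  convexHull ℝ (Set.range fun i => toR2 (P.vert i))

lemma crossZ_smul (m : ℤ) (u v : Z2) : crossZ (m • u) (m • v) = m ^ 2 * crossZ u v := by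
  simp only [crossZ, Prod.smul_fst, Prod.smul_snd, smul_eq_mul]
  ring

/-- The dilation of a polygon by a positive integer factor about the origin. -/
def dilate (P : IntPolygon) (m : ℤ) (hm : 0 < m) : IntPolygon where
  n := P.n
  vert := fun i => m • P.vert i
  convex := by
    intro i j hj hj1
    have h := P.convex i j hj hj1
    have e1 : m • P.vert (i + 1) - m • P.vert i = m • (P.vert (i + 1) - P.vert i) :=
      (smul_sub m _ _).symm
    have e2 : m • P.vert j - m • P.vert i = m • (P.vert j - P.vert i) :=
      (smul_sub m _ _).symm
    rw [e1, e2, crossZ_smul]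
    exact mul_pos (pow_pos hm 2) h

end IntPolygon

/-- `P` is a coding polygon for `X`: for each vertex `w`, the polygon with `w`
removed X-codes `w`. -/
def IsCodingPolygon {A : Type*} (X : Set (Config A)) (P : IntPolygon) : Prop :=
  ∀ i : Fin (P.n + 3),
    Codes X (P.carrier \ {toR2 (P.vert i)}) {toR2 (P.vert i)}

/-- `X` is polygonal with respect to `P`. -/
def Polygonal {A : Type*} (X : Set (Config A)) (P : IntPolygon) : Prop :=
  X.Infinite ∧ IsCodingPolygon X P

/-- The closed half plane `H_v = {w : v₁ w₂ − v₂ w₁ ≥ 0}` to the left of the direction `v`. -/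
def leftHalfPlane (v : ℝ × ℝ) : Set (ℝ × ℝ) := {w | 0 ≤ v.1 * w.2 - v.2 * w.1}

/-- The ray directed by `v` is expansive for `X`: `H_v` X-codes all of `ℝ²`. -/
def ExpansiveRay {A : Type*} (X : Set (Config A)) (v : ℝ × ℝ) : Prop :=
  Codes X (leftHalfPlane v) Set.univ

/-- For a primitive integer direction `v`, the line `L₀`: the translate of `L = ℝ·v`
by an integer vector, lying outside `H_v` and closest to `L`. -/
def lineL0 (v : Z2) : Set (ℝ × ℝ) := {w | (v.1 : ℝ) * w.2 - (v.2 : ℝ) * w.1 = -1}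

/-- A block of `m` consecutive lattice points on `L₀`, starting at `z`. -/
def blockOn (v z : Z2) (m : ℕ) : Set (ℝ × ℝ) :=
  (fun k : ℕ => toR2 (z + (k : ℤ) • v)) '' {k | k < m}

/-- The (nonexpansive) rational ray directed by the primitive vector `v` is closing for `X`. -/
def ClosingRay {A : Type*} (X : Set (Config A)) (v : Z2) : Prop :=
  ∃ N : ℕ, ∀ z : Z2, v.1 * z.2 - v.2 * z.1 = -1 →
    ∀ m : ℕ, N ≤ m →
      Codes X (leftHalfPlane (toR2 v) ∪ blockOn v z m) (lineL0 v)

/-- The sector (with vertex the origin) determined by the rays through `e₁` and `e₂`: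
lattice points on either ray or strictly between them. -/
def SectorZ (e₁ e₂ : Z2) : Set Z2 :=
  {p | SameRay ℝ (toR2 e₁) (toR2 p) ∨ SameRay ℝ (toR2 e₂) (toR2 p) ∨
       (0 < crossZ e₁ p ∧ 0 < crossZ p e₂)}

/-- The rational sector determined by `(e₁, e₂)` is corner coding for `X`. -/
def IsCornerCoding {A : Type*} (X : Set (Config A)) (e₁ e₂ : Z2) : Prop :=
  CodesZ X (SectorZ e₁ e₂ \ {0}) {0}

/-- The rational sector determined by `(e₁, e₂)` is weakly corner coding for `X`. -/
def IsWeaklyCornerCoding {A : Type*} (X : Set (Config A)) (e₁ e₂ : Z2) : Prop :=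
  ∃ F₀ : Set Z2, F₀.Finite ∧ F₀ ⊆ SectorZ e₁ e₂ ∧
    ∀ F : Set Z2, F.Finite → F ⊆ SectorZ e₁ e₂ →
      CodesZ X (SectorZ e₁ e₂ \ F) (SectorZ e₁ e₂ \ F₀)

/-- The sector based at the vertex `i` of the polygon `P`: lattice points in the convex
cone with apex `P.vert i` spanned by the two edges of `P` incident to that vertex. -/
def vertexSector (P : IntPolygon) (i : Fin (P.n + 3)) : Set Z2 :=
  {p | ∃ s t : ℝ, 0 ≤ s ∧ 0 ≤ t ∧
    toR2 p = toR2 (P.vert i) + s • toR2 (P.vert (i - 1) - P.vert i)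
      + t • toR2 (P.vert (i + 1) - P.vert i)}

/-- `P` is a coding polygon for some recoding of `X`. -/
def HasRecodingPolygon {A : Type*} (X : Set (Config A)) (P : IntPolygon) : Prop :=
  ∃ (A' : Type) (_ : Fintype A') (Y : Set (Config A')),
    IsSubshift Y ∧ IsRecoding X Y ∧ IsCodingPolygon Y P

/-- `P` is a minimal recoding polygon for `X`. -/
def IsMinimalRecodingPolygon {A : Type*} (X : Set (Config A)) (P : IntPolygon) : Prop :=
  HasRecodingPolygon X P ∧
  (∀ Q : IntPolygon, HasRecodingPolygon X Q → P.n ≤ Q.n) ∧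
  (∀ Q : IntPolygon, HasRecodingPolygon X Q → Q.n = P.n →
    Q.carrier ⊆ P.carrier → Q.carrier = P.carrier)


/-- Integer dot product. -/
def dotZ (u v : Z2) : ℤ := u.1 * v.1 + u.2 * v.2

/-- The vector `x` makes an angle in `(0, π]` with the direction `d`. -/
def HalfPlane (d x : Z2) : Prop :=
  0 ≤ crossZ d x ∧ (crossZ d x = 0 → dotZ d x < 0)

/-- The point `v` is an exposed corner of `S`: seen from `v`, all other points of `S` lie in
a half-open half plane. -/
def IsCorner (S : Finset Z2) (v : Z2) : Prop :=
  ∃ d : Z2, ∀ s ∈ S, s ≠ v → HalfPlane d (s - v)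

/-- The oriented segment from `v` to `w` is an edge of the convex hull of `S`, with `S` on its
left. -/
def IsHullEdge (S : Finset Z2) (v w : Z2) : Prop :=
  w ≠ v ∧ ∀ s ∈ S, 0 ≤ crossZ (w - v) (s - v) ∧
    (crossZ (w - v) (s - v) = 0 →
      (s ≠ v → 0 < dotZ (w - v) (s - v)) ∧ (s ≠ w → dotZ (w - v) (s - w) < 0))

lemma dotZ_self_pos {x : Z2} (hx : x ≠ 0) : 0 < dotZ x x := by
  obtain ⟨a, b⟩ := x
  simp only [dotZ]
  by_contra! h
  apply hx
  have ha : a = 0 := by nlinarith [mul_self_nonneg a, mul_self_nonneg b]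
  have hb : b = 0 := by nlinarith [mul_self_nonneg a, mul_self_nonneg b]
  simp [ha, hb]

lemma crossZ_exchange (d a x y : Z2) :
    crossZ d x * crossZ a y = crossZ d a * crossZ x y + crossZ d y * crossZ a x := by
  simp only [crossZ]; ring

lemma dotZ_self_mul_crossZ (d x y : Z2) :
    dotZ d d * crossZ x y = dotZ d x * crossZ d y - crossZ d x * dotZ d y := by
  simp only [crossZ, dotZ]; ring

lemma dotZ_self_mul_dotZ (d x y : Z2) :
    dotZ d d * dotZ x y = dotZ d x * dotZ d y + crossZ d x * crossZ d y := by
  simp only [crossZ, dotZ]; ring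

lemma crossZ_swap (x y : Z2) : crossZ y x = -crossZ x y := by
  simp only [crossZ]; ring

lemma HalfPlane.ne_zero {d x : Z2} (h : HalfPlane d x) : x ≠ 0 := by
  rintro rfl
  simpa [crossZ, dotZ] using h.2 (by simp [crossZ])

lemma HalfPlane.dir_ne_zero {d x : Z2} (h : HalfPlane d x) : d ≠ 0 := by
  rintro rfl
  simpa [crossZ, dotZ] using h.2 (by simp [crossZ])

lemma HalfPlane.crossZ_trans {d a x y : Z2} (ha : HalfPlane d a) (hx : HalfPlane d x)
    (hy : HalfPlane d y) (hax : 0 ≤ crossZ a x) (hxy : 0 ≤ crossZ x y) : 0 ≤ crossZ a y := by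
  have hd := dotZ_self_pos ha.dir_ne_zero
  rcases hx.1.lt_or_eq with h | h
  · refine nonneg_of_mul_nonneg_right ?_ h
    rw [crossZ_exchange]
    exact add_nonneg (mul_nonneg ha.1 hxy) (mul_nonneg hy.1 hax)
  · have hx' := hx.2 h.symm
    have e := dotZ_self_mul_crossZ d x y
    rw [← h] at e
    have hy0 : crossZ d y = 0 := by
      refine le_antisymm ?_ hy.1
      nlinarith [mul_nonneg hd.le hxy]
    have hy' := hy.2 hy0
    refine nonneg_of_mul_nonneg_right ?_ hd
    rw [dotZ_self_mul_crossZ, hy0]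
    nlinarith [mul_nonneg ha.1 (neg_nonneg.2 hy'.le)]

/-- Parallel vectors of a half-open half plane point in the same direction. -/
lemma HalfPlane.dotZ_pos {d x y : Z2} (hx : HalfPlane d x) (hy : HalfPlane d y)
    (h : crossZ x y = 0) : 0 < dotZ x y := by
  have hd := dotZ_self_pos hx.dir_ne_zero
  have e := dotZ_self_mul_crossZ d x y
  rw [h, mul_zero] at e
  refine pos_of_mul_pos_right ?_ hd.le
  rw [dotZ_self_mul_dotZ]
  rcases hx.1.lt_or_eq with hx1 | hx1 <;> rcases hy.1.lt_or_eq with hy1 | hy1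
  · have e2 : crossZ d x * dotZ d y = dotZ d x * crossZ d y := by linarith
    have h3 : 0 ≤ dotZ d x * dotZ d y := by
      refine nonneg_of_mul_nonneg_right (a := crossZ d x * crossZ d y) ?_ (mul_pos hx1 hy1)
      have : crossZ d x * crossZ d y * (dotZ d x * dotZ d y)
          = (dotZ d x * crossZ d y) * (crossZ d x * dotZ d y) := by ring
      rw [this, e2]
      exact mul_self_nonneg _
    linarith [mul_pos hx1 hy1]
  · have := hy.2 hy1.symm
    rw [← hy1] at e
    nlinarith
  · have := hx.2 hx1.symm
    rw [← hx1] at e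
    nlinarith
  · have h1 := hy.2 hy1.symm
    have h2 := hx.2 hx1.symm
    rw [← hx1]
    nlinarith

lemma HalfPlane.exists_first {d : Z2} (T : Finset Z2) (hT : T.Nonempty)
    (h : ∀ x ∈ T, HalfPlane d x) : ∃ x ∈ T, ∀ y ∈ T, 0 ≤ crossZ x y := by
  induction hT using Finset.Nonempty.cons_induction with
  | singleton a => exact ⟨a, by simp, by simp [crossZ, mul_comm]⟩
  | cons a T ha hT ih =>
    obtain ⟨x, hx, hxT⟩ := ih fun y hy => h y (by simp [hy])
    have haa : crossZ a a = 0 := by simp [crossZ, mul_comm]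
    by_cases hxa : 0 ≤ crossZ x a
    · refine ⟨x, by simp [hx], fun y hy => ?_⟩
      rcases Finset.mem_cons.1 hy with rfl | hy
      · exact hxa
      · exact hxT y hy
    · refine ⟨a, by simp, fun y hy => ?_⟩
      rcases Finset.mem_cons.1 hy with rfl | hy'
      · exact haa.ge
      · refine HalfPlane.crossZ_trans (h a (by simp)) (h x (by simp [hx])) (h y hy) ?_ (hxT y hy')
        rw [crossZ_swap]
        linarith

/-- Among finitely many vectors of a half-open half plane, there is a longest one of minimal
angle. -/
lemma HalfPlane.exists_first_longest {d : Z2} (T : Finset Z2) (hT : T.Nonempty)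
    (h : ∀ x ∈ T, HalfPlane d x) :
    ∃ x ∈ T, ∀ y ∈ T, 0 ≤ crossZ x y ∧ (crossZ x y = 0 → dotZ y y ≤ dotZ x x) := by
  obtain ⟨x, hx, hxT⟩ := HalfPlane.exists_first T hT h
  have hxx : crossZ x x = 0 := by simp [crossZ, mul_comm]
  obtain ⟨z, hz, hzT⟩ := Finset.exists_max_image (T.filter fun y => crossZ x y = 0)
    (fun y => dotZ y y) ⟨x, by simp [hx, hxx]⟩
  rw [Finset.mem_filter] at hz
  have hpos := dotZ_self_pos (h x hx).ne_zero
  have hxz := (h x hx).dotZ_pos (h z hz.1) hz.2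
  have key : ∀ y, dotZ x x * crossZ z y = dotZ x z * crossZ x y := fun y => by
    rw [dotZ_self_mul_crossZ, hz.2]; ring
  refine ⟨z, hz.1, fun y hy => ⟨?_, fun h0 => hzT y ?_⟩⟩
  · refine nonneg_of_mul_nonneg_right ?_ hpos
    rw [key]
    exact mul_nonneg hxz.le (hxT y hy)
  · have := key y
    rw [h0, mul_zero] at this
    rw [Finset.mem_filter]
    exact ⟨hy, (mul_eq_zero.1 this.symm).resolve_left hxz.ne'⟩

lemma exists_isCorner (S : Finset Z2) (hS : S.Nonempty) : ∃ v ∈ S, IsCorner S v := by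
  obtain ⟨v, hv, hmax⟩ := Finset.exists_max_image S (fun p : Z2 => toLex p) hS
  refine ⟨v, hv, (0, 1), fun s hs hne => ?_⟩
  have h := hmax s hs
  obtain ⟨a, b⟩ := s
  obtain ⟨a', b'⟩ := v
  rw [Prod.Lex.toLex_le_toLex] at h
  simp only [HalfPlane, crossZ, dotZ, Prod.mk_sub_mk, ne_eq, Prod.mk.injEq] at *
  omega

/-- From every corner starts an edge of the convex hull. -/
lemma IsCorner.exists_isHullEdge {S : Finset Z2} {v : Z2} (hv : IsCorner S v)
    (hS : ∃ s ∈ S, s ≠ v) : ∃ w ∈ S, IsHullEdge S v w := by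
  obtain ⟨d, hd⟩ := hv
  obtain ⟨s₀, hs₀, hne₀⟩ := hS
  obtain ⟨x, hx, hxT⟩ := HalfPlane.exists_first_longest (d := d)
    ((S.erase v).image fun s => s - v) ⟨s₀ - v, by
      exact Finset.mem_image_of_mem _ (Finset.mem_erase.2 ⟨hne₀, hs₀⟩)⟩ (by
      intro x hx
      obtain ⟨s, hs, rfl⟩ := Finset.mem_image.1 hx
      exact hd s (Finset.mem_of_mem_erase hs) (Finset.ne_of_mem_erase hs))
  obtain ⟨w, hw, rfl⟩ := Finset.mem_image.1 hx
  obtain ⟨hwv, hw⟩ := Finset.mem_erase.1 hw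
  refine ⟨w, hw, hwv, fun s hs => ?_⟩
  by_cases hsv : s = v
  · subst hsv
    refine ⟨by simp [crossZ], fun _ => ⟨fun h => absurd rfl h, fun _ => ?_⟩⟩
    have := dotZ_self_pos (sub_ne_zero.2 hwv)
    have e : dotZ (w - s) (s - w) = -dotZ (w - s) (w - s) := by
      simp only [dotZ, Prod.fst_sub, Prod.snd_sub]; ring
    omega
  · obtain ⟨h1, h2⟩ := hxT (s - v)
      (Finset.mem_image_of_mem _ (Finset.mem_erase.2 ⟨hsv, hs⟩))
    refine ⟨h1, fun h0 => ?_⟩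
    have hpos := (hd w hw hwv).dotZ_pos (hd s hs hsv) h0
    refine ⟨fun _ => hpos, fun hsw => ?_⟩
    have hle := h2 h0
    have hsw' := dotZ_self_pos (sub_ne_zero.2 hsw)
    have hex : dotZ (s - w) (s - w)
        = dotZ (s - v) (s - v) + dotZ (w - v) (w - v) - 2 * dotZ (w - v) (s - v) := by
      simp only [dotZ, Prod.fst_sub, Prod.snd_sub]; ring
    have hex2 : dotZ (w - v) (s - w) = dotZ (w - v) (s - v) - dotZ (w - v) (w - v) := by
      simp only [dotZ, Prod.fst_sub, Prod.snd_sub]; ring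
    have hlag : dotZ (w - v) (w - v) * dotZ (s - v) (s - v)
        = dotZ (w - v) (s - v) ^ 2 := by
      rw [dotZ_self_mul_dotZ, h0]; ring
    have hww := dotZ_self_pos (sub_ne_zero.2 hwv)
    rw [hex2]
    have hle' : dotZ (w - v) (s - v) ≤ dotZ (w - v) (w - v) := by nlinarith
    rcases hle'.lt_or_eq with h | h
    · linarith
    · rw [h] at hlag
      nlinarith

lemma IsHullEdge.isCorner {S : Finset Z2} {v w : Z2} (h : IsHullEdge S v w) :
    IsCorner S w := by
  refine ⟨w - v, fun s hs hsw => ?_⟩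
  have e : crossZ (w - v) (s - w) = crossZ (w - v) (s - v) := by
    simp only [crossZ, Prod.fst_sub, Prod.snd_sub]; ring
  rw [HalfPlane, e]
  exact ⟨(h.2 s hs).1, fun h0 => ((h.2 s hs).2 h0).2 hsw⟩

/-- A corner that is not an endpoint of a hull edge lies strictly to its left. -/
lemma IsHullEdge.crossZ_pos {S : Finset Z2} {v w s : Z2} (h : IsHullEdge S v w)
    (hv : v ∈ S) (hw : w ∈ S) (hs : s ∈ S) (hc : IsCorner S s) (hsv : s ≠ v) (hsw : s ≠ w) :
    0 < crossZ (w - v) (s - v) := by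
  refine lt_of_le_of_ne (h.2 s hs).1 fun h0 => ?_
  obtain ⟨h1, h2⟩ := (h.2 s hs).2 h0.symm
  have h1 := h1 hsv
  have h2 := h2 hsw
  obtain ⟨d, hd⟩ := hc
  have hvs := hd v hv hsv.symm
  have hws := hd w hw hsw.symm
  have hpar : crossZ (v - s) (w - s) = 0 := by
    rw [h0]; simp only [crossZ, Prod.fst_sub, Prod.snd_sub]; ring
  have hpos := hvs.dotZ_pos hws hpar
  have hww := dotZ_self_pos (sub_ne_zero.2 h.1)
  have e := dotZ_self_mul_dotZ (w - v) (v - s) (w - s)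
  have e1 : dotZ (w - v) (v - s) = -dotZ (w - v) (s - v) := by
    simp only [dotZ, Prod.fst_sub, Prod.snd_sub]; ring
  have e2 : dotZ (w - v) (w - s) = -dotZ (w - v) (s - w) := by
    simp only [dotZ, Prod.fst_sub, Prod.snd_sub]; ring
  have e3 : crossZ (w - v) (v - s) = 0 := by
    rw [← neg_eq_zero, h0]; simp only [crossZ, Prod.fst_sub, Prod.snd_sub]; ring
  rw [e1, e2, e3] at e
  nlinarith [mul_pos hww hpos]

lemma toR2_mem_convexHull_triangle {a b c p : Z2} {C : Set (ℝ × ℝ)} (hC : Convex ℝ C)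
    (ha : toR2 a ∈ C) (hb : toR2 b ∈ C) (hc : toR2 c ∈ C) (hD : 0 < crossZ (b - a) (c - a))
    (h₁ : 0 ≤ crossZ (b - a) (p - a)) (h₂ : crossZ (c - a) (p - a) ≤ 0)
    (h₃ : 0 ≤ crossZ (c - b) (p - b)) : toR2 p ∈ C := by
  have hD' : (0 : ℝ) < crossZ (b - a) (c - a) := by exact_mod_cast hD
  have key := hC.sum_mem (t := Finset.univ)
    (w := ![(crossZ (c - b) (p - b) : ℝ) / crossZ (b - a) (c - a),
      -(crossZ (c - a) (p - a) : ℝ) / crossZ (b - a) (c - a),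
      (crossZ (b - a) (p - a) : ℝ) / crossZ (b - a) (c - a)])
    (z := ![toR2 a, toR2 b, toR2 c])
    (by
      have h₁' : (0 : ℝ) ≤ crossZ (b - a) (p - a) := by exact_mod_cast h₁
      have h₂' : (crossZ (c - a) (p - a) : ℝ) ≤ 0 := by exact_mod_cast h₂
      have h₃' : (0 : ℝ) ≤ crossZ (c - b) (p - b) := by exact_mod_cast h₃
      intro i _
      fin_cases i
      · exact div_nonneg h₃' hD'.le
      · exact div_nonneg (neg_nonneg.2 h₂') hD'.le
      · exact div_nonneg h₁' hD'.le)
    (by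
      simp only [Fin.sum_univ_three, Matrix.cons_val]
      rw [← add_div, ← add_div, div_eq_one_iff_eq hD'.ne']
      simp only [crossZ, Prod.fst_sub, Prod.snd_sub]
      push_cast
      ring)
    (by
      intro i _
      fin_cases i
      · exact ha
      · exact hb
      · exact hc)
  convert key using 1
  simp only [Fin.sum_univ_three, Matrix.cons_val]
  apply Prod.ext <;>
  · simp only [toR2, Prod.fst_add, Prod.snd_add, Prod.smul_fst, Prod.smul_snd, smul_eq_mul]
    rw [div_mul_eq_mul_div, div_mul_eq_mul_div, div_mul_eq_mul_div, ← add_div, ← add_div,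
      eq_div_iff hD'.ne']
    simp only [crossZ, Prod.fst_sub, Prod.snd_sub]
    push_cast
    ring

/-- A lattice point to the left of all edges of a polygon belongs to the polygon. -/
lemma IntPolygon.toR2_mem_carrier (P : IntPolygon) (p : Z2)
    (h : ∀ i, 0 ≤ crossZ (P.vert (i + 1) - P.vert i) (p - P.vert i)) :
    toR2 p ∈ P.carrier := by
  set u : ℕ → Z2 := fun k => P.vert (Fin.ofNat (P.n + 3) k) with hu
  have hmem : ∀ k, toR2 (u k) ∈ P.carrier := fun k =>
    subset_convexHull ℝ _ (Set.mem_range_self _)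
  have hcast : ∀ k, Fin.ofNat (P.n + 3) (k + 1) = Fin.ofNat (P.n + 3) k + 1 := fun k =>
    Fin.ext (by simp [Fin.val_add])
  have hedge : ∀ k, 0 ≤ crossZ (u (k + 1) - u k) (p - u k) := fun k => by
    simpa only [hu, hcast] using h (Fin.ofNat (P.n + 3) k)
  have hlast : u (P.n + 2 + 1) = u 0 := by
    simp only [hu]
    congr 1
    exact Fin.ext (by simp)
  have hend : crossZ (u (P.n + 1 + 1) - u 0) (p - u 0) ≤ 0 := by
    have := hedge (P.n + 2)
    rw [hlast] at this
    have e : crossZ (u (P.n + 1 + 1) - u 0) (p - u 0)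
        = -crossZ (u 0 - u (P.n + 2)) (p - u (P.n + 2)) := by
      change crossZ (u (P.n + 2) - u 0) (p - u 0) = _
      simp only [crossZ, Prod.fst_sub, Prod.snd_sub]; ring
    omega
  classical
  have hex : ∃ k, 1 ≤ k ∧ crossZ (u (k + 1) - u 0) (p - u 0) ≤ 0 :=
    ⟨P.n + 1, by omega, hend⟩
  obtain ⟨hk1, hk⟩ := Nat.find_spec hex
  have hkn : Nat.find hex ≤ P.n + 1 := Nat.find_min' hex ⟨by omega, hend⟩
  have hmin := fun m => Nat.find_min hex (m := m)
  generalize Nat.find hex = k at *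
  have hfst : 0 ≤ crossZ (u k - u 0) (p - u 0) := by
    rcases Nat.lt_or_ge 1 k with h1 | h1
    · obtain ⟨m, rfl⟩ : ∃ m, k = m + 1 := ⟨k - 1, by omega⟩
      have := hmin m (by omega)
      push Not at this
      exact (this (by omega)).le
    · obtain rfl : k = 1 := by omega
      exact hedge 0
  have hne : ∀ m : ℕ, 1 ≤ m → m ≤ P.n + 2 → (0 : Fin (P.n + 3)) ≠ Fin.ofNat (P.n + 3) m := by
    intro m h1 h2 h0
    have := congrArg Fin.val h0
    rw [Fin.val_ofNat, Nat.mod_eq_of_lt (by omega), Fin.val_zero] at this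
    omega
  have hD := P.convex (Fin.ofNat (P.n + 3) k) 0 (hne k hk1 (by omega))
    (by simpa only [hcast] using hne (k + 1) (by omega) (by omega))
  refine toR2_mem_convexHull_triangle (convex_convexHull ℝ _) (hmem 0) (hmem k) (hmem (k + 1))
    ?_ hfst hk (hedge k)
  have e : crossZ (u k - u 0) (u (k + 1) - u 0) = crossZ (u (k + 1) - u k) (u 0 - u k) := by
    simp only [crossZ, Prod.fst_sub, Prod.snd_sub]; ring
  rw [e]
  simpa only [hu, hcast, Fin.ofNat_zero] using hD

lemma exists_mem_periodicPts {α : Type*} [Finite α] [Nonempty α] (f : α → α) :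
    ∃ x, x ∈ Function.periodicPts f := by
  obtain ⟨x⟩ := ‹Nonempty α›
  obtain ⟨a, b, hab, h⟩ := Finite.exists_ne_map_eq_of_infinite fun k : ℕ => f^[k] x
  wlog hlt : a < b generalizing a b
  · exact this b a hab.symm h.symm (by omega)
  refine ⟨f^[a] x, b - a, by omega, ?_⟩
  rw [Function.IsPeriodicPt, Function.IsFixedPt, ← Function.iterate_add_apply,
    Nat.sub_add_cancel hlt.le]
  exact h.symm

/-- The convex hull of a finite noncollinear set of lattice points is an integer polygon with
vertices in that set. -/
lemma exists_intPolygon_hull (S : Finset Z2) (hne : S.Nonempty)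
    (hS : ∀ v w : Z2, v ∈ S → w ≠ v → ∃ s ∈ S, crossZ (w - v) (s - v) ≠ 0) :
    ∃ P : IntPolygon, (∀ i, P.vert i ∈ S) ∧ ∀ s ∈ S, toR2 s ∈ P.carrier := by
  have hstep : ∀ v : {v // v ∈ S ∧ IsCorner S v},
      ∃ w : {v // v ∈ S ∧ IsCorner S v}, IsHullEdge S v w := by
    rintro ⟨v, hv, hc⟩
    obtain ⟨s, hs, hs0⟩ := hS v (v + (1, 0)) hv (by simp)
    obtain ⟨w, hw, hvw⟩ := hc.exists_isHullEdge
      ⟨s, hs, fun h => hs0 (by simp [h, crossZ])⟩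
    exact ⟨⟨w, hw, hvw.isCorner⟩, hvw⟩
  choose f hf using hstep
  have : Finite {v // v ∈ S ∧ IsCorner S v} :=
    Finite.of_injective (fun v => (⟨v.1, v.2.1⟩ : S))
      fun a b h => Subtype.ext (congrArg (fun z : S => (z : Z2)) h)
  obtain ⟨v₀, hv₀, hc₀⟩ := exists_isCorner S hne
  have : Nonempty {v // v ∈ S ∧ IsCorner S v} := ⟨⟨v₀, hv₀, hc₀⟩⟩
  obtain ⟨e, he⟩ := exists_mem_periodicPts f
  have hpos := Function.minimalPeriod_pos_of_mem_periodicPts he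
  have hper : f^[Function.minimalPeriod f e] e = e := Function.iterate_minimalPeriod
  have h1 : Function.minimalPeriod f e ≠ 1 := by
    intro h
    rw [h] at hper
    exact (hf e).1 (congrArg Subtype.val hper)
  have h2 : Function.minimalPeriod f e ≠ 2 := by
    intro h
    rw [h] at hper
    have hper : f (f e) = e := hper
    obtain ⟨s, hs, hs0⟩ := hS e (f e) e.2.1 (hf e).1
    have ha := ((hf e).2 s hs).1
    have hb := ((hf (f e)).2 s hs).1
    rw [hper] at hb
    apply hs0
    refine le_antisymm ?_ ha
    have e' : crossZ ((f e).1 - e.1) (s - e.1) = -crossZ (e.1 - (f e).1) (s - (f e).1) := by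
      simp only [crossZ, Prod.fst_sub, Prod.snd_sub]; ring
    omega
  obtain ⟨n, hn⟩ : ∃ n, Function.minimalPeriod f e = n + 3 :=
    ⟨Function.minimalPeriod f e - 3, by omega⟩
  have hsucc : ∀ i : Fin (n + 3), f^[(i + 1 : Fin (n + 3)).val] e = f (f^[i.val] e) := by
    intro i
    have h := Function.iterate_mod_minimalPeriod_eq (f := f) (x := e) (n := i.val + 1)
    rw [hn] at h
    rw [← Function.iterate_succ_apply' f, Fin.val_add]
    exact h
  have hinj : ∀ i j : Fin (n + 3), f^[i.val] e = f^[j.val] e → i = j := by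
    intro i j h
    refine Fin.ext (Function.iterate_injOn_Iio_minimalPeriod ?_ ?_ h)
    · rw [Set.mem_Iio, hn]; exact i.2
    · rw [Set.mem_Iio, hn]; exact j.2
  have hedge : ∀ i : Fin (n + 3),
      IsHullEdge S (f^[i.val] e).1 (f^[(i + 1 : Fin (n + 3)).val] e).1 := by
    intro i
    rw [hsucc]
    exact hf _
  let P : IntPolygon :=
    { n := n
      vert := fun i => (f^[i.val] e).1
      convex := fun i j hj hj1 =>
        (hedge i).crossZ_pos (f^[i.val] e).2.1 (f^[(i + 1 : Fin (n + 3)).val] e).2.1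
          (f^[j.val] e).2.1 (f^[j.val] e).2.2
          (fun h => hj (hinj _ _ (Subtype.ext h))) (fun h => hj1 (hinj _ _ (Subtype.ext h))) }
  exact ⟨P, fun i => (f^[i.val] e).2.1,
    fun s hs => P.toR2_mem_carrier s fun i => ((hedge i).2 s hs).1⟩

lemma toR2_add (a b : Z2) : toR2 (a + b) = toR2 a + toR2 b := by
  simp [toR2]

/-- If a translate of the polygon `Q` by `b` lies inside the convex set `C`, then `C` minus the
translated vertex codes that vertex. -/
lemma IsCodingPolygon.codes_translate {A : Type*} {X : Set (Config A)} {Q : IntPolygon}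
    (hQ : IsCodingPolygon X Q) (hX : ∀ u : Z2, ∀ x ∈ X, shiftAct u x ∈ X)
    {C : Set (ℝ × ℝ)} (hC : Convex ℝ C) (b : Z2) (hb : ∀ i, toR2 (b + Q.vert i) ∈ C)
    (i : Fin (Q.n + 3)) :
    Codes X (C \ {toR2 (b + Q.vert i)}) {toR2 (b + Q.vert i)} := by
  intro x hx x' hx' hagree p hp
  have hinj : Function.Injective toR2 := fun p q h => by
    simp only [toR2, Prod.mk.injEq, Int.cast_inj] at h
    exact Prod.ext h.1 h.2
  obtain rfl : p = b + Q.vert i := hinj hp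
  refine hQ i _ (hX b x hx) _ (hX b x' hx') (fun q hq => hagree (b + q) ⟨?_, ?_⟩) _ rfl
  · rw [toR2_add]
    have hsub : Q.carrier ⊆ (fun z => toR2 b + z) ⁻¹' C := by
      refine convexHull_min ?_ (hC.translate_preimage_right _)
      rintro _ ⟨j, rfl⟩
      simpa [toR2_add] using hb j
    exact hsub hq.1
  · intro h
    exact hq.2 (congrArg toR2 (add_left_cancel (hinj h)))

/-- the product of two polygonal subshifts is polygonal. -/
theorem statement4 {A₁ A₂ : Type} [Fintype A₁] [Nonempty A₁] [Fintype A₂] [Nonempty A₂]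
    (X₁ : Set (Config A₁)) (X₂ : Set (Config A₂))
    (hX₁ : IsSubshift X₁) (hX₂ : IsSubshift X₂)
    (P₁ P₂ : IntPolygon) (h₁ : Polygonal X₁ P₁) (h₂ : Polygonal X₂ P₂) :
    ∃ P : IntPolygon,
      Polygonal {y : Config (A₁ × A₂) |
        (fun p => (y p).1) ∈ X₁ ∧ (fun p => (y p).2) ∈ X₂} P := by
  classical
  set S : Finset Z2 := Finset.univ.image
    fun ij : Fin (P₁.n + 3) × Fin (P₂.n + 3) => P₁.vert ij.1 + P₂.vert ij.2 with hSdef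
  have hmem : ∀ i j, P₁.vert i + P₂.vert j ∈ S := fun i j =>
    Finset.mem_image_of_mem _ (Finset.mem_univ (i, j))
  obtain ⟨P, hPS, hP⟩ := exists_intPolygon_hull S ⟨_, hmem 0 0⟩ (by
    intro v w _ hwv
    by_contra! hcol
    have h2 : (2 : Fin (P₁.n + 3)).val = 2 := Fin.val_two
    have hpos := P₁.convex 0 2 (by rw [ne_eq, Fin.ext_iff, h2]; simp)
      (by rw [ne_eq, Fin.ext_iff, h2]; simp)
    have e0 := hcol _ (hmem 0 0)
    have e1 := hcol _ (hmem (0 + 1) 0)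
    have e2 := hcol _ (hmem 2 0)
    have hdot := dotZ_self_pos (sub_ne_zero.2 hwv)
    have key := dotZ_self_mul_crossZ (w - v) (P₁.vert (0 + 1) - P₁.vert 0)
      (P₁.vert 2 - P₁.vert 0)
    have c1 : crossZ (w - v) (P₁.vert (0 + 1) - P₁.vert 0) = 0 := by
      simp only [crossZ, Prod.fst_sub, Prod.snd_sub, Prod.fst_add, Prod.snd_add] at *
      linarith
    have c2 : crossZ (w - v) (P₁.vert 2 - P₁.vert 0) = 0 := by
      simp only [crossZ, Prod.fst_sub, Prod.snd_sub, Prod.fst_add, Prod.snd_add] at *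
      linarith
    rw [c1, c2] at key
    nlinarith [mul_pos hdot hpos])
  refine ⟨P, ?_, ?_⟩
  · obtain ⟨x₂, hx₂⟩ := h₂.1.nonempty
    refine Set.infinite_of_injOn_mapsTo (f := fun (x : Config A₁) p => (x p, x₂ p)) ?_
      (fun x hx => ⟨hx, hx₂⟩) h₁.1
    intro x _ x' _ h
    funext p
    exact congrArg Prod.fst (congrFun h p)
  · intro k
    obtain ⟨⟨i, j⟩, -, hij⟩ := Finset.mem_image.1 (hPS k)
    have hC : Convex ℝ P.carrier := convex_convexHull ℝ _
    have hc₂ := h₂.2.codes_translate hX₂.2 hC (P₁.vert i) (fun l => hP _ (hmem i l)) j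
    have hc₁ := h₁.2.codes_translate hX₁.2 hC (P₂.vert j)
      (fun l => hP _ (by rw [add_comm]; exact hmem l j)) i
    rw [add_comm] at hc₁
    rw [← hij]
    intro y hy y' hy' hagree p hp
    exact Prod.ext
      (hc₁ _ hy.1 _ hy'.1 (fun q hq => congrArg Prod.fst (hagree q hq)) p hp)
      (hc₂ _ hy.2 _ hy'.2 (fun q hq => congrArg Prod.snd (hagree q hq)) p hp)

end PolygonalShifts
end

section
/- Let ℓ₁ and ℓ₂ be nonparallel closing rays for a ℤ²-subshift X₀, let S₀ be the sector determined by (ℓ₁, ℓ₂), and assume every ray contained in the interior of the cone spanned by ℓ₁ and ℓ₂ is expansive for X₀. Let S_s be the supplementary sector determined by (ℓ₂, −ℓ₁). Then X₀ can be recoded to a ℤ²-subshift X₁ for which S_s is corner coding. -/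
namespace PolygonalShifts

open Filter Topology

/-! ### Compactness -/

lemma exists_finite_codesZ {A : Type*} [TopologicalSpace A] [DiscreteTopology A] [Finite A]
    {X : Set (Config A)} (hX : IsClosed X) {S : Set Z2} {q : Z2}
    (h : CodesZ X S {q}) : ∃ T ⊆ S, T.Finite ∧ CodesZ X T {q} := by
  have hopen : ∀ p : Z2, IsClopen {y : Config A × Config A | y.1 p ≠ y.2 p} := fun p =>
    (isClopen_discrete {z : A × A | z.1 ≠ z.2}).preimage
      (f := fun y : Config A × Config A => (y.1 p, y.2 p)) (by fun_prop)
  have hK : IsCompact ((X ×ˢ X) ∩ {y : Config A × Config A | y.1 q ≠ y.2 q}) :=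
    ((hX.prod hX).inter (hopen q).isClosed).isCompact
  obtain ⟨T, hTS, hTfin, hT⟩ := hK.elim_finite_subcover_image (b := S)
    (fun p _ => (hopen p).isOpen) (by
      rintro ⟨x, x'⟩ ⟨⟨hx, hx'⟩, hne⟩
      by_contra hcon
      simp only [Set.mem_iUnion, Set.mem_ofPred_eq, not_exists, not_not] at hcon
      exact hne (h x hx x' hx' hcon q rfl))
  refine ⟨T, hTS, hTfin, fun x hx x' hx' hag p hp => ?_⟩
  rw [Set.mem_singleton_iff.1 hp]
  by_contra hne
  have hmem := hT (show (x, x') ∈ _ from ⟨⟨hx, hx'⟩, hne⟩)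
  simp only [Set.mem_iUnion, Set.mem_ofPred_eq] at hmem
  obtain ⟨t, ht, hxt⟩ := hmem
  exact hxt (hag t ht)

/-! ### Block codes -/

/-- The sliding block code with local rule `g`. -/
def blockCode {A A' : Type*} (g : Config A → A') (x : Config A) : Config A' :=
  fun u => g (shiftAct u x)

lemma blockCode_shiftAct {A A' : Type*} (g : Config A → A') (u : Z2) (x : Config A) :
    blockCode g (shiftAct u x) = shiftAct u (blockCode g x) := by
  funext w
  refine congrArg g (funext fun v => ?_)
  simp only [shiftAct, add_assoc]

lemma continuous_blockCode {A A' : Type*} [TopologicalSpace A] [DiscreteTopology A]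
    [TopologicalSpace A'] {F : Set Z2} {g : Config A → A'} (hF : F.Finite)
    (hg : ∀ x x', g x = g x' ↔ ∀ f ∈ F, x f = x' f) : Continuous (blockCode g) := by
  have hgc : Continuous g := by
    refine IsLocallyConstant.continuous ((IsLocallyConstant.iff_exists_open g).2 fun x => ?_)
    refine ⟨⋂ f ∈ F, {y | y f = x f}, hF.isOpen_biInter fun f _ => ?_, by simp, ?_⟩
    · exact (isOpen_discrete ({x f} : Set A)).preimage
        (continuous_apply (A := fun _ : Z2 => A) f)
    · intro y hy
      exact (hg y x).2 (by simpa using hy)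
  refine continuous_pi fun u => hgc.comp ?_
  exact continuous_pi fun w => continuous_apply (u + w)

lemma blockCode_injective {A A' : Type*} {F : Set Z2} {g : Config A → A'} (hne : F.Nonempty)
    (hg : ∀ x x', g x = g x' ↔ ∀ f ∈ F, x f = x' f) : Function.Injective (blockCode g) := by
  intro x x' h
  obtain ⟨f, hf⟩ := hne
  funext p
  have := (hg _ _).1 (congrFun h (p - f)) f hf
  simpa [shiftAct] using this

/-- The image of a subshift under a block code that remembers exactly the restriction to a
finite nonempty window `F` is a subshift, and a recoding via `F`. -/
lemma isSubshift_isRecodingVia_image {A A' : Type*} [Finite A] {X : Set (Config A)}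
    (hX : IsSubshift X) {F : Set Z2} (hF : F.Finite) (hne : F.Nonempty) {g : Config A → A'}
    (hg : ∀ x x', g x = g x' ↔ ∀ f ∈ F, x f = x' f) :
    IsSubshift (blockCode g '' X) ∧ IsRecodingVia X (blockCode g '' X) F := by
  let _ : TopologicalSpace A := ⊥
  let _ : TopologicalSpace A' := ⊥
  have : DiscreteTopology A := ⟨rfl⟩
  have : DiscreteTopology A' := ⟨rfl⟩
  have hcont := continuous_blockCode hF hg
  have hinj := blockCode_injective hne hg
  have hXc : IsCompact X := IsClosed.isCompact hX.1
  refine ⟨⟨(hXc.image hcont).isClosed, ?_⟩, ?_⟩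
  · rintro u _ ⟨x, hx, rfl⟩
    exact ⟨shiftAct u x, hX.2 u x hx, blockCode_shiftAct g u x⟩
  · have : CompactSpace X := isCompact_iff_compactSpace.1 hXc
    let e : X ≃ (blockCode g '' X : Set (Config A')) := Equiv.Set.image _ X hinj
    have he : Continuous e := (hcont.comp continuous_subtype_val).subtype_mk _
    refine ⟨he.homeoOfEquivCompactToT2, ?_, ?_⟩
    · intro u x x' h
      change blockCode g (x' : Config A) = shiftAct u (blockCode g (x : Config A))
      rw [h, blockCode_shiftAct]
    · intro u x x'
      change g (shiftAct u (x : Config A)) = g (shiftAct u (x' : Config A)) ↔ _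
      rw [hg]
      simp only [shiftAct, add_comm u]

/-! ### Coding windows -/

/-- A finite set `W` is a coding window for `X` if agreement on `u + W` forces agreement
at `u`. -/
def IsCodingWindow {A : Type*} (X : Set (Config A)) (W : Set Z2) : Prop :=
  W.Finite ∧ ∀ x ∈ X, ∀ x' ∈ X, ∀ u, (∀ w ∈ W, x (u + w) = x' (u + w)) → x u = x' u

lemma exists_isCodingWindow {A : Type*} [Finite A] {X : Set (Config A)} (hX : IsSubshift X)
    {S : Set Z2} {q : Z2} (h : CodesZ X S {q}) :
    ∃ W, IsCodingWindow X W ∧ ∀ w ∈ W, w + q ∈ S := by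
  let _ : TopologicalSpace A := ⊥
  have : DiscreteTopology A := ⟨rfl⟩
  obtain ⟨T, hTS, hT, hcode⟩ := exists_finite_codesZ hX.1 h
  refine ⟨(fun t => t - q) '' T, ⟨hT.image _, fun x hx x' hx' u hag => ?_⟩, ?_⟩
  · have := hcode _ (hX.2 (u - q) x hx) _ (hX.2 (u - q) x' hx') (fun t ht => ?_) q rfl
    · simpa [shiftAct] using this
    · have h1 := hag _ (Set.mem_image_of_mem _ ht)
      rw [show u + (t - q) = u - q + t by abel] at h1
      exact h1
  · rintro _ ⟨t, ht, rfl⟩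
    simpa using hTS ht

section Cross

variable (v p q : Z2)

lemma crossZ_add_right : crossZ v (p + q) = crossZ v p + crossZ v q := by
  simp only [crossZ, Prod.fst_add, Prod.snd_add]; ring

lemma crossZ_sub_right : crossZ v (p - q) = crossZ v p - crossZ v q := by
  simp only [crossZ, Prod.fst_sub, Prod.snd_sub]; ring

lemma crossZ_neg_right : crossZ v (-p) = -crossZ v p := by
  simp only [crossZ, Prod.fst_neg, Prod.snd_neg]; ring

lemma crossZ_smul_right (n : ℤ) : crossZ v (n • p) = n * crossZ v p := by
  simp only [crossZ, Prod.smul_fst, Prod.smul_snd, smul_eq_mul]; ring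

lemma crossZ_self : crossZ v v = 0 := by
  simp only [crossZ]; ring

lemma crossZ_swap_s13 : crossZ p v = -crossZ v p := by
  simp only [crossZ]; ring

lemma toR2_mem_leftHalfPlane : toR2 p ∈ leftHalfPlane (toR2 v) ↔ 0 ≤ crossZ v p := by
  simp only [toR2, leftHalfPlane, crossZ, Set.mem_ofPred_eq]
  norm_cast

end Cross

/-- An expansive direction has a coding window in the corresponding open half plane. -/
lemma ExpansiveRay.exists_isCodingWindow {A : Type*} [Finite A] {X : Set (Config A)}
    (hX : IsSubshift X) {u : ℝ × ℝ} (h : ExpansiveRay X u) {q : Z2} (hq : crossR u (toR2 q) < 0) :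
    ∃ W, IsCodingWindow X W ∧ ∀ w ∈ W, 0 < crossR u (toR2 w) := by
  obtain ⟨W, hW, hWS⟩ := PolygonalShifts.exists_isCodingWindow hX
    (S := {p | toR2 p ∈ leftHalfPlane u}) (q := q)
    (fun x hx x' hx' hag p _ => h x hx x' hx' hag p trivial)
  refine ⟨W, hW, fun w hw => ?_⟩
  have h1 := hWS w hw
  simp only [leftHalfPlane, Set.mem_ofPred_eq, toR2, Prod.fst_add, Prod.snd_add, Int.cast_add]
    at h1
  simp only [crossR, toR2] at hq ⊢
  linarith

/-- A closing ray has coding windows consisting of points strictly to the left, together with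
points on the line of the ray that lie ahead (or, alternatively, behind). -/
lemma ClosingRay.exists_isCodingWindow {A : Type*} [Finite A] {X : Set (Config A)}
    (hX : IsSubshift X) {v : Z2} (hv : Int.gcd v.1 v.2 = 1) (h : ClosingRay X v)
    {σ : ℤ} (hσ : σ = 1 ∨ σ = -1) :
    ∃ W, IsCodingWindow X W ∧
      ∀ w ∈ W, 1 ≤ crossZ v w ∨ ∃ k : ℤ, 0 < k ∧ w = (σ * k) • v := by
  obtain ⟨N, hN⟩ := h
  obtain ⟨z, hz⟩ : ∃ z : Z2, crossZ v z = -1 := by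
    have hb := Int.gcd_eq_gcd_ab v.1 v.2
    rw [hv] at hb
    refine ⟨(Int.gcdB v.1 v.2, -Int.gcdA v.1 v.2), ?_⟩
    simp only [crossZ]
    push_cast at hb
    linarith
  have key : ∀ r : ℤ, (∀ k : ℕ, k < N → 0 < σ * (k - r)) → ∃ W, IsCodingWindow X W ∧
      ∀ w ∈ W, 1 ≤ crossZ v w ∨ ∃ k : ℤ, 0 < k ∧ w = (σ * k) • v := by
    intro r hr
    have hq : crossZ v (z + r • v) = -1 := by
      rw [crossZ_add_right, crossZ_smul_right, crossZ_self, hz]; ring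
    obtain ⟨W, hW, hWS⟩ := PolygonalShifts.exists_isCodingWindow hX
      (S := {p | toR2 p ∈ leftHalfPlane (toR2 v) ∪ blockOn v z N}) (q := z + r • v)
      (fun x hx x' hx' hag p hp => hN z hz N le_rfl x hx x' hx' hag p (by
        rw [Set.mem_singleton_iff.1 hp]
        simp only [lineL0, toR2, Set.mem_ofPred_eq]
        exact_mod_cast hq))
    refine ⟨W, hW, fun w hw => ?_⟩
    rcases hWS w hw with h1 | ⟨k, hk, h1⟩
    · rw [toR2_mem_leftHalfPlane, crossZ_add_right, hq] at h1
      left; linarith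
    · right
      refine ⟨σ * (k - r), hr k hk, ?_⟩
      have h2 : z + (k : ℤ) • v = w + (z + r • v) := by
        simp only [toR2, Prod.mk.injEq, Int.cast_inj] at h1
        exact Prod.ext h1.1 h1.2
      have h3 : σ * (σ * ((k : ℤ) - r)) = k - r := by
        rcases hσ with rfl | rfl <;> ring
      rw [h3, sub_smul, eq_sub_of_add_eq h2.symm]
      abel
  rcases hσ with rfl | rfl
  · exact key (-1) fun k _ => by omega
  · exact key N fun k _ => by omega

/-! ### Propagation of agreement in the quadrant -/

/-- If coding windows are available for all directions `(s, t) > 0`, and near the two axes,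
then far from the origin each point of the quadrant has a window inside the quadrant on which
the quadratic form `a b + ε (a² + b²)` increases strictly. -/
lemma exists_window_increasing (a b : Z2 → ℤ) (𝒲 : Set (Set Z2))
    (hfin : ∀ W ∈ 𝒲, W.Finite)
    (hab : ∀ s t : ℝ, 0 < s → 0 < t → ∃ W ∈ 𝒲, ∀ w ∈ W, 0 < s * a w + t * b w)
    (ha : ∃ W ∈ 𝒲, ∀ w ∈ W, 1 ≤ a w ∨ (a w = 0 ∧ 0 < b w))
    (hb : ∃ W ∈ 𝒲, ∀ w ∈ W, 1 ≤ b w ∨ (b w = 0 ∧ 0 < a w)) :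
    ∃ ε : ℝ, 0 < ε ∧ ε < 1 ∧ ∃ K : ℝ, 0 < K ∧ ∀ x y : ℝ, 0 ≤ x → 0 ≤ y → K < x + y →
      ∃ W ∈ 𝒲, ∀ w ∈ W, 0 ≤ x + a w ∧ 0 ≤ y + b w ∧
        x * y + ε * (x ^ 2 + y ^ 2) <
          (x + a w) * (y + b w) + ε * ((x + a w) ^ 2 + (y + b w) ^ 2) := by
  obtain ⟨W₁, hW₁, ha⟩ := ha
  obtain ⟨W₂, hW₂, hb⟩ := hb
  have small : ∀ c d : ℤ, (1 ≤ c ∨ (c = 0 ∧ 0 < d)) →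
      ∀ᶠ ε : ℝ in 𝓝[>] 0, 0 < (c : ℝ) + 2 * ε * d := by
    rintro c d (h | ⟨rfl, h⟩)
    · have hc : (0 : ℝ) < c := by exact_mod_cast h
      refine nhdsWithin_le_nhds ?_
      have : ContinuousAt (fun ε : ℝ => (c : ℝ) + 2 * ε * d) 0 := by fun_prop
      exact this.eventually (lt_mem_nhds (by simpa using hc))
    · have hd : (0 : ℝ) < d := by exact_mod_cast h
      filter_upwards [self_mem_nhdsWithin] with ε hε
      have : (0 : ℝ) < ε := hε
      push_cast
      positivity
  obtain ⟨ε, hε₁, hε₂, hε0, hε⟩ :=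
    (((eventually_all_finite (hfin _ hW₁)).2 fun w hw => small _ _ (ha w hw)).and
      (((eventually_all_finite (hfin _ hW₂)).2 fun w hw => small _ _ (hb w hw)).and
        (Ioo_mem_nhdsGT (zero_lt_one (α := ℝ))))).exists
  refine ⟨ε, hε0, hε, ?_⟩
  let Good : ℝ → ℝ → Prop := fun l α => 0 ≤ l → 0 ≤ α → α ≤ 1 → ∃ W ∈ 𝒲, ∀ w ∈ W,
    0 ≤ α + l * a w ∧ 0 ≤ 1 - α + l * b w ∧
      0 < (1 - α + 2 * ε * α) * a w + (α + 2 * ε * (1 - α)) * b w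
        + l * (a w * b w + ε * ((a w : ℝ) ^ 2 + (b w : ℝ) ^ 2))
  have good_of : ∀ α₀ ∈ Set.Icc (0 : ℝ) 1, ∀ W ∈ 𝒲,
      (∀ w ∈ W, (0 < α₀ ∨ 0 ≤ a w) ∧ (α₀ < 1 ∨ 0 ≤ b w) ∧
        0 < (1 - α₀ + 2 * ε * α₀) * a w + (α₀ + 2 * ε * (1 - α₀)) * b w) →
      ∀ᶠ z : ℝ × ℝ in 𝓝 (0, α₀), Good z.1 z.2 := by
    intro α₀ hα₀ W hW h
    have hev : ∀ w ∈ W, ∀ᶠ z : ℝ × ℝ in 𝓝 (0, α₀), 0 ≤ z.1 → 0 ≤ z.2 → z.2 ≤ 1 →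
        0 ≤ z.2 + z.1 * a w ∧ 0 ≤ 1 - z.2 + z.1 * b w ∧
        0 < (1 - z.2 + 2 * ε * z.2) * a w + (z.2 + 2 * ε * (1 - z.2)) * b w
          + z.1 * (a w * b w + ε * ((a w : ℝ) ^ 2 + (b w : ℝ) ^ 2)) := by
      intro w hw
      obtain ⟨h1, h2, h3⟩ := h w hw
      have e1 : ∀ᶠ z : ℝ × ℝ in 𝓝 (0, α₀), 0 ≤ z.1 → 0 ≤ z.2 → 0 ≤ z.2 + z.1 * a w := by
        rcases h1 with h1 | h1
        · have : ContinuousAt (fun z : ℝ × ℝ => z.2 + z.1 * a w) (0, α₀) := by fun_prop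
          filter_upwards [this.eventually (lt_mem_nhds (by simpa using h1))] with z hz _ _
          exact hz.le
        · have : (0 : ℝ) ≤ a w := by exact_mod_cast h1
          exact Eventually.of_forall fun z _ _ => by positivity
      have e2 : ∀ᶠ z : ℝ × ℝ in 𝓝 (0, α₀), 0 ≤ z.1 → z.2 ≤ 1 →
          0 ≤ 1 - z.2 + z.1 * b w := by
        rcases h2 with h2 | h2
        · have : ContinuousAt (fun z : ℝ × ℝ => 1 - z.2 + z.1 * b w) (0, α₀) := by fun_prop
          have h2' : (0 : ℝ) < 1 - α₀ + 0 * b w := by linarith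
          filter_upwards [this.eventually (lt_mem_nhds h2')] with z hz _ _
          exact hz.le
        · have : (0 : ℝ) ≤ b w := by exact_mod_cast h2
          refine Eventually.of_forall fun z hz hz1 => ?_
          have := mul_nonneg hz this
          linarith
      have e3 : ContinuousAt (fun z : ℝ × ℝ =>
          (1 - z.2 + 2 * ε * z.2) * a w + (z.2 + 2 * ε * (1 - z.2)) * b w
          + z.1 * (a w * b w + ε * ((a w : ℝ) ^ 2 + (b w : ℝ) ^ 2))) (0, α₀) := by fun_prop
      filter_upwards [e1, e2, e3.eventually (lt_mem_nhds (by simpa using h3))]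
        with z hz1 hz2 hz3 h4 h5 h6
      exact ⟨hz1 h4 h5, hz2 h4 h6, hz3⟩
    filter_upwards [(eventually_all_finite (hfin W hW)).2 hev] with z hz h4 h5 h6
    exact ⟨W, hW, fun w hw => hz w hw h4 h5 h6⟩
  have hgood : ∀ α₀ ∈ Set.Icc (0 : ℝ) 1, ∀ᶠ z : ℝ × ℝ in 𝓝 (0, α₀), Good z.1 z.2 := by
    intro α₀ hα₀
    rcases hα₀.1.eq_or_lt with rfl | h0
    · refine good_of _ hα₀ W₁ hW₁ fun w hw => ⟨Or.inr ?_, Or.inl one_pos, ?_⟩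
      · have := ha w hw
        omega
      · simpa using hε₁ w hw
    rcases hα₀.2.eq_or_lt with rfl | h1
    · refine good_of _ hα₀ W₂ hW₂ fun w hw => ⟨Or.inl one_pos, Or.inr ?_, ?_⟩
      · have := hb w hw
        omega
      · have := hε₂ w hw
        ring_nf at this ⊢
        linarith
    have h1' : 0 < 1 - α₀ := sub_pos.2 h1
    obtain ⟨W, hW, h⟩ := hab (1 - α₀ + 2 * ε * α₀) (α₀ + 2 * ε * (1 - α₀))
      (by positivity) (by positivity)
    exact good_of _ hα₀ W hW fun w hw => ⟨Or.inl h0, Or.inl h1, h w hw⟩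
  have hall : ∀ᶠ l : ℝ in 𝓝 0, ∀ α ∈ Set.Icc (0 : ℝ) 1, Good l α :=
    isCompact_Icc.eventually_forall_of_forall_eventually hgood
  obtain ⟨r, hr, hr'⟩ := Metric.eventually_nhds_iff.1 hall
  refine ⟨1 / r, by positivity, fun x y hx hy hxy => ?_⟩
  have hS : 0 < x + y := lt_trans (by positivity) hxy
  have hl : 0 < 1 / (x + y) := by positivity
  have hα1 : 1 - x / (x + y) = y / (x + y) := by field_simp; ring
  obtain ⟨W, hW, h⟩ := hr' (y := 1 / (x + y)) (by
      rw [Real.dist_eq, sub_zero, abs_of_pos hl]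
      rwa [one_div_lt hr hS] at *) (x / (x + y))
    ⟨by positivity, by rw [div_le_one hS]; linarith⟩ hl.le (by positivity)
    (by rw [div_le_one hS]; linarith)
  refine ⟨W, hW, fun w hw => ?_⟩
  obtain ⟨h1, h2, h3⟩ := h w hw
  rw [hα1] at h2 h3
  have e1 : x / (x + y) + 1 / (x + y) * a w = (x + a w) / (x + y) := by ring
  have e2 : y / (x + y) + 1 / (x + y) * b w = (y + b w) / (x + y) := by ring
  have e3 : (y / (x + y) + 2 * ε * (x / (x + y))) * a w
      + (x / (x + y) + 2 * ε * (y / (x + y))) * b w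
      + 1 / (x + y) * (a w * b w + ε * ((a w : ℝ) ^ 2 + (b w : ℝ) ^ 2))
      = ((x + a w) * (y + b w) + ε * ((x + a w) ^ 2 + (y + b w) ^ 2)
        - (x * y + ε * (x ^ 2 + y ^ 2))) / (x + y) := by ring
  rw [e1] at h1
  rw [e2] at h2
  rw [e3] at h3
  refine ⟨?_, ?_, ?_⟩
  · simpa using (le_div_iff₀ hS).1 h1
  · simpa using (le_div_iff₀ hS).1 h2
  · exact sub_pos.1 ((div_pos_iff_of_pos_right hS).1 h3)

/-- Agreement on all but finitely many points of the quadrant `{a ≥ 0, b ≥ 0}` implies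
agreement outside of a fixed box. -/
lemma exists_bound_of_finite_disagreement (a b : Z2 → ℤ)
    (hadd : ∀ p q, a (p + q) = a p + a q ∧ b (p + q) = b p + b q) (𝒲 : Set (Set Z2))
    (hfin : ∀ W ∈ 𝒲, W.Finite)
    (hab : ∀ s t : ℝ, 0 < s → 0 < t → ∃ W ∈ 𝒲, ∀ w ∈ W, 0 < s * a w + t * b w)
    (ha : ∃ W ∈ 𝒲, ∀ w ∈ W, 1 ≤ a w ∨ (a w = 0 ∧ 0 < b w))
    (hb : ∃ W ∈ 𝒲, ∀ w ∈ W, 1 ≤ b w ∨ (b w = 0 ∧ 0 < a w)) :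
    ∃ K : ℤ, 0 < K ∧ ∀ P : Z2 → Prop,
      (∀ W ∈ 𝒲, ∀ u, (∀ w ∈ W, P (u + w)) → P u) →
      {p | 0 ≤ a p ∧ 0 ≤ b p ∧ ¬ P p}.Finite →
      ∀ p, 0 ≤ a p → 0 ≤ b p → (K ≤ a p ∨ K ≤ b p) → P p := by
  obtain ⟨ε, hε0, hε1, K, hK, h⟩ := exists_window_increasing a b 𝒲 hfin hab ha hb
  let φ : Z2 → ℝ := fun p => a p * b p + ε * ((a p : ℝ) ^ 2 + (b p : ℝ) ^ 2)
  obtain ⟨n, hn⟩ := exists_nat_gt (K ^ 2 / ε)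
  refine ⟨n + 1, by positivity, fun P hcode hΔ p hpa hpb hpK => ?_⟩
  by_contra hp
  obtain ⟨m, ⟨hma, hmb, hmP⟩, hmax⟩ := Set.exists_max_image _ φ hΔ ⟨p, hpa, hpb, hp⟩
  have hle := hmax p ⟨hpa, hpb, hp⟩
  have hpa' : (0 : ℝ) ≤ a p := by exact_mod_cast hpa
  have hpb' : (0 : ℝ) ≤ b p := by exact_mod_cast hpb
  have hma' : (0 : ℝ) ≤ a m := by exact_mod_cast hma
  have hmb' : (0 : ℝ) ≤ b m := by exact_mod_cast hmb
  have hlow : K ^ 2 < φ p := by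
    have hKn : K ^ 2 < n * ε := (div_lt_iff₀ hε0).1 hn
    have hsq : ∀ y : ℤ, (n : ℤ) + 1 ≤ y → (n : ℝ) ≤ (y : ℝ) ^ 2 := fun y hy => by
      have : (n : ℝ) + 1 ≤ y := by exact_mod_cast hy
      nlinarith [Nat.cast_nonneg (α := ℝ) n]
    have hsum : (n : ℝ) ≤ (a p : ℝ) ^ 2 + (b p : ℝ) ^ 2 := by
      rcases hpK with h1 | h1
      · linarith [hsq _ h1, sq_nonneg (b p : ℝ)]
      · linarith [hsq _ h1, sq_nonneg (a p : ℝ)]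
    have := mul_le_mul_of_nonneg_left hsum hε0.le
    have := mul_nonneg hpa' hpb'
    change K ^ 2 < a p * b p + ε * ((a p : ℝ) ^ 2 + (b p : ℝ) ^ 2)
    linarith
  have hbig : K < a m + b m := by
    by_contra hcon
    have h1 : ((a m : ℝ) + b m) ^ 2 ≤ K ^ 2 :=
      pow_le_pow_left₀ (by positivity) (not_lt.1 hcon) 2
    have h2 : φ m ≤ ((a m : ℝ) + b m) ^ 2 := by
      change a m * b m + ε * ((a m : ℝ) ^ 2 + (b m : ℝ) ^ 2) ≤ _
      have := mul_le_mul_of_nonneg_right hε1.le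
        (show 0 ≤ (a m : ℝ) ^ 2 + (b m : ℝ) ^ 2 by positivity)
      nlinarith [mul_nonneg hma' hmb']
    linarith
  obtain ⟨W, hW, hinc⟩ := h _ _ hma' hmb' hbig
  refine hmP (hcode W hW m fun w hw => ?_)
  obtain ⟨h1, h2, h3⟩ := hinc w hw
  by_contra hPw
  have := hmax (m + w) ⟨by rw [(hadd m w).1]; exact_mod_cast h1,
    by rw [(hadd m w).2]; exact_mod_cast h2, hPw⟩
  simp only [φ, (hadd m w).1, (hadd m w).2, Int.cast_add] at this
  linarith


/-! ### The supplementary sector -/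

section Sector

variable {e₁ e₂ : Z2}

lemma crossZ_smul_eq (e₁ e₂ p : Z2) :
    crossZ e₁ e₂ • p = crossZ e₁ p • e₂ - crossZ e₂ p • e₁ := by
  ext <;> simp only [crossZ, Prod.smul_fst, Prod.smul_snd, Prod.fst_sub, Prod.snd_sub,
    smul_eq_mul] <;> ring

lemma toR2_smul (n : ℤ) (p : Z2) : toR2 (n • p) = (n : ℝ) • toR2 p := by
  simp [toR2]

lemma mem_sectorZ_supplementary (hor : 0 < crossZ e₁ e₂) {p : Z2} (ha : 0 ≤ crossZ e₁ p)
    (hb : 0 ≤ crossZ e₂ p) : p ∈ SectorZ e₂ (-e₁) := by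
  have hp := crossZ_smul_eq e₁ e₂ p
  have hor' : (0 : ℝ) < crossZ e₁ e₂ := by exact_mod_cast hor
  rcases ha.eq_or_lt with ha | ha
  · rcases hb.eq_or_lt with hb | hb
    · left
      rw [← ha, ← hb, zero_smul, zero_smul, sub_zero] at hp
      rw [(smul_eq_zero.1 hp).resolve_left hor.ne']
      exact Or.inr (Or.inl (by simp [toR2]))
    · right; left
      refine Or.inr (Or.inr ⟨crossZ e₂ p, crossZ e₁ e₂, by exact_mod_cast hb, hor', ?_⟩)
      rw [← toR2_smul, ← toR2_smul, hp, ← ha, zero_smul, zero_sub, smul_neg]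
  · rcases hb.eq_or_lt with hb | hb
    · left
      refine Or.inr (Or.inr ⟨crossZ e₁ p, crossZ e₁ e₂, by exact_mod_cast ha, hor', ?_⟩)
      rw [← toR2_smul, ← toR2_smul, hp, ← hb, zero_smul, sub_zero]
    · right; right
      refine ⟨hb, ?_⟩
      have : crossZ p (-e₁) = crossZ e₁ p := by rw [crossZ_neg_right, crossZ_swap_s13 e₁, neg_neg]
      rwa [this]

lemma finite_box (hor : 0 < crossZ e₁ e₂) (M : ℤ) :
    {p : Z2 | 0 ≤ crossZ e₁ p ∧ 0 ≤ crossZ e₂ p ∧ crossZ e₁ p ≤ M ∧ crossZ e₂ p ≤ M}.Finite := by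
  refine Set.Finite.of_injOn (f := fun p => (crossZ e₁ p, crossZ e₂ p))
    (t := Set.Icc 0 M ×ˢ Set.Icc 0 M) ?_ ?_ ((Set.finite_Icc 0 M).prod (Set.finite_Icc 0 M))
  · rintro p ⟨h1, h2, h3, h4⟩
    exact ⟨⟨h1, h3⟩, ⟨h2, h4⟩⟩
  · intro p _ q _ h
    simp only [Prod.mk.injEq] at h
    have := crossZ_smul_eq e₁ e₂ p
    rw [h.1, h.2, ← crossZ_smul_eq] at this
    exact smul_right_injective _ hor.ne' this

end Sector

lemma exists_reduction {D K : ℤ} (hD : 0 < D) (hK : 0 ≤ K) {c : ℤ} (hc : 0 ≤ c) :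
    ∃ j : ℤ, 0 ≤ j ∧ 0 ≤ c - j * D ∧ c - j * D ≤ K + D ∧
      (K + D < c → 0 < j ∧ K ≤ c - j * D) := by
  by_cases h : c ≤ K + D
  · exact ⟨0, le_rfl, by omega, by omega, fun h' => by omega⟩
  · have h1 := Int.mul_ediv_add_emod (c - K) D
    have h2 := Int.emod_nonneg (c - K) hD.ne'
    have h3 := Int.emod_lt_of_pos (c - K) hD
    have h4 : 0 < (c - K) / D := by
      by_contra hcon
      nlinarith [Int.mul_ediv_add_emod (c - K) D]
    rw [mul_comm] at h1
    exact ⟨(c - K) / D, h4.le, by linarith, by linarith, fun _ => ⟨h4, by linarith⟩⟩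

/-- Every point of the sector outside the box of size `K + D` is a translate, by a nonzero point
of the sector, of a point of the box lying outside the box of size `K`. -/
lemma exists_sub_sector {e₁ e₂ : Z2} (hor : 0 < crossZ e₁ e₂) {K : ℤ} (hK : 0 ≤ K) {p : Z2}
    (ha : 0 ≤ crossZ e₁ p) (hb : 0 ≤ crossZ e₂ p)
    (hp : K + crossZ e₁ e₂ < crossZ e₁ p ∨ K + crossZ e₁ e₂ < crossZ e₂ p) :
    ∃ s ∈ SectorZ e₂ (-e₁) \ {0}, 0 ≤ crossZ e₁ (p - s) ∧ 0 ≤ crossZ e₂ (p - s) ∧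
      crossZ e₁ (p - s) ≤ K + crossZ e₁ e₂ ∧ crossZ e₂ (p - s) ≤ K + crossZ e₁ e₂ ∧
      (K ≤ crossZ e₁ (p - s) ∨ K ≤ crossZ e₂ (p - s)) := by
  obtain ⟨j, hj0, hj1, hj2, hj3⟩ := exists_reduction hor hK ha
  obtain ⟨i, hi0, hi1, hi2, hi3⟩ := exists_reduction hor hK hb
  have h1 : crossZ e₁ (j • e₂ - i • e₁) = j * crossZ e₁ e₂ := by
    rw [crossZ_sub_right, crossZ_smul_right, crossZ_smul_right, crossZ_self]; ring
  have h2 : crossZ e₂ (j • e₂ - i • e₁) = i * crossZ e₁ e₂ := by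
    rw [crossZ_sub_right, crossZ_smul_right, crossZ_smul_right, crossZ_self,
      crossZ_swap_s13 e₁ e₂]; ring
  refine ⟨j • e₂ - i • e₁, ⟨mem_sectorZ_supplementary hor ?_ ?_, ?_⟩, ?_⟩
  · rw [h1]; positivity
  · rw [h2]; positivity
  · intro h0
    rw [Set.mem_singleton_iff.1 h0] at h1 h2
    simp only [crossZ, Prod.fst_zero, Prod.snd_zero, mul_zero, sub_zero] at h1 h2
    rcases hp with h | h
    · exact (mul_pos (hj3 h).1 hor).ne h1
    · exact (mul_pos (hi3 h).1 hor).ne h2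
  · rw [crossZ_sub_right e₁ p, crossZ_sub_right e₂ p, h1, h2]
    exact ⟨hj1, hi1, hj2, hi2, hp.imp (fun h => (hj3 h).2) fun h => (hi3 h).2⟩

/-- if `ℓ₁, ℓ₂` are nonparallel closing rays for `X₀` and every ray in
the interior of the cone they span is expansive, then `X₀` recodes to a subshift `X₁`
for which the supplementary sector (determined by `(ℓ₂, −ℓ₁)`) is corner coding. -/
theorem statement13 {A : Type} [Fintype A] [Nonempty A] (X₀ : Set (Config A))
    (hX : IsSubshift X₀)
    (e₁ e₂ : Z2) (hprim₁ : Int.gcd e₁.1 e₁.2 = 1) (hprim₂ : Int.gcd e₂.1 e₂.2 = 1)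
    (hor : 0 < crossZ e₁ e₂)
    (hne₁ : ¬ ExpansiveRay X₀ (toR2 e₁)) (hne₂ : ¬ ExpansiveRay X₀ (toR2 e₂))
    (hcl₁ : ClosingRay X₀ e₁) (hcl₂ : ClosingRay X₀ e₂)
    (hint : ∀ u : ℝ × ℝ, u ≠ 0 → 0 < crossR (toR2 e₁) u → 0 < crossR u (toR2 e₂) →
      ExpansiveRay X₀ u) :
    ∃ (A' : Type) (_ : Fintype A') (X₁ : Set (Config A')),
      IsSubshift X₁ ∧ IsRecoding X₀ X₁ ∧ IsCornerCoding X₁ e₂ (-e₁) := by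
  have hab : ∀ s t : ℝ, 0 < s → 0 < t → ∃ W ∈ {W | IsCodingWindow X₀ W},
      ∀ w ∈ W, 0 < s * crossZ e₁ w + t * crossZ e₂ w := by
    intro s t hs ht
    have hor' : (0 : ℝ) < crossZ e₁ e₂ := by exact_mod_cast hor
    let u : ℝ × ℝ := s • toR2 e₁ + t • toR2 e₂
    have hu : ∀ p, crossR u (toR2 p) = s * crossZ e₁ p + t * crossZ e₂ p := fun p => by
      simp only [u, crossR, crossZ, toR2, Prod.fst_add, Prod.snd_add, Prod.smul_fst,
        Prod.smul_snd, smul_eq_mul]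
      push_cast
      ring
    have hu1 : crossR (toR2 e₁) u = t * crossZ e₁ e₂ := by
      simp only [u, crossR, crossZ, toR2, Prod.fst_add, Prod.snd_add, Prod.smul_fst,
        Prod.smul_snd, smul_eq_mul]
      push_cast
      ring
    have hu2 : crossR u (toR2 e₂) = s * crossZ e₁ e₂ := by
      rw [hu, crossZ_self]; simp
    have hexp := hint u (by rintro h; simp [h, crossR] at hu2; exact hu2.elim hs.ne' hor.ne')
      (by rw [hu1]; positivity) (by rw [hu2]; positivity)
    obtain ⟨W, hW, hpos⟩ := hexp.exists_isCodingWindow hX (q := -e₂) (by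
      rw [hu, crossZ_neg_right, crossZ_neg_right, crossZ_self]
      push_cast
      nlinarith [mul_pos hs hor'])
    exact ⟨W, hW, fun w hw => by rw [← hu]; exact hpos w hw⟩
  have ha : ∃ W ∈ {W | IsCodingWindow X₀ W},
      ∀ w ∈ W, 1 ≤ crossZ e₁ w ∨ (crossZ e₁ w = 0 ∧ 0 < crossZ e₂ w) := by
    obtain ⟨W, hW, h⟩ := hcl₁.exists_isCodingWindow hX hprim₁ (σ := -1) (Or.inr rfl)
    refine ⟨W, hW, fun w hw => (h w hw).imp_right ?_⟩
    rintro ⟨k, hk, rfl⟩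
    rw [crossZ_smul_right, crossZ_smul_right, crossZ_self, crossZ_swap_s13 e₁ e₂]
    exact ⟨mul_zero _, by nlinarith [mul_pos hk hor]⟩
  have hb : ∃ W ∈ {W | IsCodingWindow X₀ W},
      ∀ w ∈ W, 1 ≤ crossZ e₂ w ∨ (crossZ e₂ w = 0 ∧ 0 < crossZ e₁ w) := by
    obtain ⟨W, hW, h⟩ := hcl₂.exists_isCodingWindow hX hprim₂ (σ := 1) (Or.inl rfl)
    refine ⟨W, hW, fun w hw => (h w hw).imp_right ?_⟩
    rintro ⟨k, hk, rfl⟩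
    rw [crossZ_smul_right, crossZ_smul_right, crossZ_self]
    exact ⟨mul_zero _, by nlinarith [mul_pos hk hor]⟩
  obtain ⟨K, hK, hprop⟩ := exists_bound_of_finite_disagreement (crossZ e₁) (crossZ e₂)
    (fun p q => ⟨crossZ_add_right _ _ _, crossZ_add_right _ _ _⟩) {W | IsCodingWindow X₀ W}
    (fun W hW => hW.1) hab ha hb
  set D := crossZ e₁ e₂
  let F : Set Z2 := {p | 0 ≤ crossZ e₁ p ∧ 0 ≤ crossZ e₂ p ∧ crossZ e₁ p ≤ K * D + D ∧
    crossZ e₂ p ≤ K * D + D ∧ (K * D ≤ crossZ e₁ p ∨ K * D ≤ crossZ e₂ p)}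
  have hKD : K ≤ K * D := le_mul_of_one_le_right hK.le hor
  have hF : F.Finite := (finite_box hor (K * D + D)).subset
    fun p hp => ⟨hp.1, hp.2.1, hp.2.2.1, hp.2.2.2.1⟩
  have hFne : F.Nonempty := by
    refine ⟨K • e₂, ?_⟩
    have h1 : crossZ e₁ (K • e₂) = K * D := crossZ_smul_right _ _ _
    have h2 : crossZ e₂ (K • e₂) = 0 := by rw [crossZ_smul_right, crossZ_self, mul_zero]
    simp only [F, Set.mem_ofPred_eq, h1, h2]
    refine ⟨?_, le_rfl, ?_, ?_, Or.inl le_rfl⟩ <;> linarith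
  have := hF.to_subtype
  let g : Config A → (F → A) := fun x f => x f
  have hg : ∀ x x', g x = g x' ↔ ∀ f ∈ F, x f = x' f := fun x x' => by
    simp [g, funext_iff]
  obtain ⟨h1, h2⟩ := isSubshift_isRecodingVia_image hX hF hFne hg
  refine ⟨F → A, Fintype.ofFinite _, _, h1, ⟨F, hF, h2⟩, ?_⟩
  rintro _ ⟨x, hx, rfl⟩ _ ⟨x', hx', rfl⟩ hag p rfl
  refine (hg (shiftAct 0 x) (shiftAct 0 x')).2 fun f hf => ?_
  simp only [shiftAct, zero_add]
  refine hprop (fun p => x p = x' p) (fun W hW => hW.2 x hx x' hx') ?_ f hf.1 hf.2.1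
    (hf.2.2.2.2.imp hKD.trans hKD.trans)
  refine (finite_box hor (K * D + D)).subset ?_
  rintro p ⟨hpa, hpb, hne⟩
  refine ⟨hpa, hpb, ?_⟩
  by_contra hcon
  obtain ⟨s, hs, hsF⟩ := exists_sub_sector hor (hK.le.trans hKD) hpa hpb
    (by rw [not_and_or] at hcon; simpa using hcon)
  have := (hg (shiftAct s x) (shiftAct s x')).1 (hag s hs) (p - s) hsF
  simp only [shiftAct, add_sub_cancel] at this
  exact hne this

end PolygonalShifts
end

section
/- Suppose the ℤ²-subshift X has two antiparallel rays ℓ and −ℓ, both nonexpansive and closing for X, lying in a rational line L through the origin, and suppose that one of the two open half planes bounded by L contains the direction vector of no nonexpansive ray of X. Then ℓ and −ℓ are the only nonexpansive rays of X, and L is a periodic direction for X: there exists a nonzero vector p ∈ L ∩ ℤ² such that T^p x = x for every x ∈ X. -/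
namespace PolygonalShifts

section Codes

variable {A : Type} {X : Set (Config A)}

lemma CodesZ.mono {S S' T : Set Z2} (h : CodesZ X S T) (hS : S ⊆ S') : CodesZ X S' T :=
  fun x hx x' hx' hxx' => h x hx x' hx' fun p hp => hxx' p (hS hp)

/-- Translating a coding statement for a single site. -/
lemma CodesZ.apply_eq (hX : IsSubshift X) {S : Set Z2} (h : CodesZ X S {0}) {x x' : Config A}
    (hx : x ∈ X) (hx' : x' ∈ X) (q : Z2) (hq : ∀ w ∈ S, x (q + w) = x' (q + w)) :
    x q = x' q := by
  have := h (shiftAct q x) (hX.2 q x hx) (shiftAct q x') (hX.2 q x' hx') hq 0 rfl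
  simpa [shiftAct] using this

/-- By compactness, a site coded by a set is coded by a finite subset of it. -/
lemma CodesZ.exists_finset [Finite A] (hX : IsSubshift X) {S : Set Z2} {q : Z2}
    (h : CodesZ X S {q}) : ∃ F : Finset Z2, (F : Set Z2) ⊆ S ∧ CodesZ X F {q} := by
  let _ : TopologicalSpace A := ⊥
  have : DiscreteTopology A := ⟨rfl⟩
  have hXc : IsClosed X := hX.1
  have hK : IsClosed {z : Config A × Config A | z.1 ∈ X ∧ z.2 ∈ X ∧ z.1 q ≠ z.2 q} := by
    refine (hXc.preimage continuous_fst).inter ((hXc.preimage continuous_snd).inter ?_)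
    have hcont : Continuous fun z : Config A × Config A => (z.1 q, z.2 q) :=
      ((continuous_apply q).comp continuous_fst).prodMk
        ((continuous_apply q).comp continuous_snd)
    exact (isClosed_discrete {a : A × A | a.1 ≠ a.2}).preimage hcont
  have hC : ∀ p : S, IsClosed {z : Config A × Config A | z.1 p = z.2 p} := fun p =>
    isClosed_eq ((continuous_apply _).comp continuous_fst)
      ((continuous_apply _).comp continuous_snd)
  obtain ⟨t, ht⟩ := hK.isCompact.elim_finite_subfamily_closed _ hC (by
    refine Set.eq_empty_of_forall_notMem ?_
    rintro z ⟨⟨h1, h2, h3⟩, h4⟩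
    exact h3 (h z.1 h1 z.2 h2 (fun p hp => Set.mem_iInter.1 h4 ⟨p, hp⟩) q rfl))
  classical
  refine ⟨t.image Subtype.val, ?_, ?_⟩
  · intro p hp
    obtain ⟨r, -, rfl⟩ := Finset.mem_image.1 (Finset.mem_coe.1 hp)
    exact r.2
  · rintro x hx x' hx' hxx' p rfl
    by_contra hne
    have hmem : (x, x') ∈ ({z : Config A × Config A | z.1 ∈ X ∧ z.2 ∈ X ∧ z.1 p ≠ z.2 p} ∩
        ⋂ i ∈ t, {z : Config A × Config A | z.1 i = z.2 i}) := by
      refine ⟨⟨hx, hx', hne⟩, ?_⟩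
      simp only [Set.mem_iInter]
      exact fun i hi => hxx' _ (Finset.mem_coe.2 (Finset.mem_image_of_mem _ hi))
    rw [ht] at hmem
    exact hmem

lemma exists_nat_bound (F : Finset Z2) : ∃ D : ℕ, ∀ w ∈ F, |w.1| ≤ D ∧ |w.2| ≤ D := by
  refine ⟨F.sup fun w => w.1.natAbs + w.2.natAbs, fun w hw => ?_⟩
  have := Finset.le_sup (f := fun w : Z2 => w.1.natAbs + w.2.natAbs) hw
  rw [Int.abs_eq_natAbs, Int.abs_eq_natAbs]
  omega

/-- Uniformity of the coding windows for a compact set of slopes. -/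
lemma exists_uniform_window [Finite A] (hX : IsSubshift X)
    (hexp : ∀ s : ℝ, CodesZ X {w | (w.1 : ℝ) ≤ s * w.2 - 2} {0}) {K : Set ℝ}
    (hK : IsCompact K) :
    ∃ D : ℕ, ∀ s ∈ K,
      CodesZ X {w | (w.1 : ℝ) ≤ s * w.2 - 3 / 2 ∧ |w.1| ≤ D ∧ |w.2| ≤ D} {0} := by
  refine hK.induction_on ⟨0, by simp⟩ ?_ ?_ ?_
  · rintro s t hst ⟨D, hD⟩
    exact ⟨D, fun r hr => hD r (hst hr)⟩
  · rintro s t ⟨D, hD⟩ ⟨E, hE⟩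
    refine ⟨D + E, fun r hr => ?_⟩
    rcases hr with hr | hr
    · refine (hD r hr).mono fun w hw => ⟨hw.1, ?_, ?_⟩ <;> have := hw.2 <;> push_cast <;> omega
    · refine (hE r hr).mono fun w hw => ⟨hw.1, ?_, ?_⟩ <;> have := hw.2 <;> push_cast <;> omega
  · intro s _
    obtain ⟨F, hFS, hF⟩ := (hexp s).exists_finset hX
    obtain ⟨D, hD⟩ := exists_nat_bound F
    refine ⟨Metric.ball s (1 / (2 * (D + 1))),
      mem_nhdsWithin_of_mem_nhds (Metric.ball_mem_nhds s (by positivity)), D, fun r hr => ?_⟩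
    refine hF.mono fun w hw => ⟨?_, hD w hw⟩
    have h1 : (w.1 : ℝ) ≤ s * w.2 - 2 := hFS hw
    have h2 : |(w.2 : ℝ)| ≤ D := by exact_mod_cast (hD w hw).2
    rw [Metric.mem_ball, Real.dist_eq] at hr
    have h3 : |(r - s) * w.2| ≤ 1 / 2 := by
      rw [abs_mul]
      calc |r - s| * |(w.2 : ℝ)| ≤ 1 / (2 * (D + 1)) * (D + 1) := by
            gcongr
            linarith
        _ = 1 / 2 := by field_simp
    have h4 := (abs_le.1 h3).1
    nlinarith

/-- A finite window coding its own horizontal translate forces a common period. -/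
lemma exists_period_of_window [Finite A] (hX : IsSubshift X) (P : Finset Z2) (hP0 : 0 ∈ P)
    (hP : ∀ x ∈ X, ∀ x' ∈ X, (∀ p ∈ P, x p = x' p) → ∀ p ∈ P, x (p + (1, 0)) = x' (p + (1, 0))) :
    ∃ n : ℕ, 0 < n ∧ ∀ x ∈ X, shiftAct ((n : ℤ), 0) x = x := by
  have hstep : ∀ x ∈ X, ∀ k l : ℤ,
      (∀ p ∈ P, x (p + (k, 0)) = x (p + (l, 0))) →
      ∀ j : ℕ, ∀ p ∈ P, x (p + (k + j, 0)) = x (p + (l + j, 0)) := by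
    intro x hx k l hkl j
    induction j with
    | zero => simpa using hkl
    | succ j ih =>
      intro p hp
      have := hP (shiftAct (k + j, 0) x) (hX.2 _ x hx) (shiftAct (l + j, 0) x) (hX.2 _ x hx)
        (fun p hp => by simpa [shiftAct, add_comm] using ih p hp) p hp
      simp only [shiftAct] at this
      convert this using 2 <;> ext <;> simp <;> ring
  have : Fintype (P → A) := Fintype.ofFinite _
  set c := Fintype.card (P → A)
  refine ⟨c.factorial, c.factorial_pos, ?_⟩
  have hzero : ∀ x ∈ X, x ((c.factorial : ℤ), 0) = x 0 := by
    intro x hx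
    obtain ⟨a, b, hab, heq⟩ := Fintype.exists_ne_map_eq_of_card_lt
      (fun (i : Fin (c + 1)) (p : P) => x ((p : Z2) + (-(i : ℤ), 0))) (by simp [c])
    have main : ∀ a b : ℕ, b < a → a ≤ c →
        (∀ p ∈ P, x (p + (-(a : ℤ), 0)) = x (p + (-(b : ℤ), 0))) →
        x ((c.factorial : ℤ), 0) = x 0 := by
      intro a b hba hac h
      obtain ⟨d, rfl⟩ := Nat.exists_eq_add_of_lt hba
      have hper : ∀ j : ℕ, x ((j : ℤ) * (d + 1), 0) = x 0 := by
        intro j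
        induction j with
        | zero => simp; rfl
        | succ j ih =>
          have := hstep x hx _ _ h (b + d + 1 + j * (d + 1)) 0 hP0
          rw [← ih]
          convert this.symm using 2 <;> ext <;> simp <;> ring
      obtain ⟨e, he⟩ := Nat.dvd_factorial (Nat.succ_pos d) (show d + 1 ≤ c by omega)
      have := hper e
      rw [he]
      convert this using 3
      push_cast
      ring
    rcases lt_or_gt_of_ne (Fin.val_ne_of_ne hab) with hlt | hlt
    · exact main b a hlt (by omega) fun p hp => (congrFun heq ⟨p, hp⟩).symm
    · exact main a b hlt (by omega) fun p hp => congrFun heq ⟨p, hp⟩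
  intro x hx
  funext q
  have := hzero (shiftAct q x) (hX.2 q x hx)
  simpa [shiftAct, add_comm] using this

/-- Horizontal periodicity, from expansiveness of all directions of slope `s` and closing of the
two horizontal directions. The window is bounded on the right by a flat parabola. -/
lemma exists_horizontal_period [Finite A] (hX : IsSubshift X)
    (hexp : ∀ s : ℝ, CodesZ X {w | (w.1 : ℝ) ≤ s * w.2 - 2} {0})
    (hup : CodesZ X {w | 0 < w.2 ∨ (w.2 = 0 ∧ w.1 < 0)} {0})
    (hdown : CodesZ X {w | w.2 < 0 ∨ (w.2 = 0 ∧ w.1 < 0)} {0}) :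
    ∃ n : ℕ, 0 < n ∧ ∀ x ∈ X, shiftAct ((n : ℤ), 0) x = x := by
  obtain ⟨F, hFS, hF⟩ := hup.exists_finset hX
  obtain ⟨G, hGS, hG⟩ := hdown.exists_finset hX
  classical
  obtain ⟨R, hR⟩ := exists_nat_bound (F ∪ G)
  obtain ⟨D, hD⟩ := exists_uniform_window hX hexp
    (isCompact_Icc (a := -((R : ℝ) + 2)) (b := (R : ℝ) + 2))
  obtain ⟨m, hm⟩ : ∃ m : ℤ, m = 2 * D ^ 2 + R ^ 2 + 1 := ⟨_, rfl⟩
  obtain ⟨h, hh⟩ : ∃ h : ℤ, h = (R + 2) * m + D + R := ⟨_, rfl⟩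
  obtain ⟨B, hB⟩ : ∃ B : ℤ, B = h ^ 2 + D + R := ⟨_, rfl⟩
  have hm0 : 0 < m := by rw [hm]; positivity
  have hRm : 0 < (R + 2) * m := by positivity
  have hh0 : 0 ≤ h := by rw [hh]; positivity
  have hB0 : 0 ≤ B := by rw [hB]; positivity
  refine exists_period_of_window hX
    ((Finset.Icc ((-B, -h) : Z2) (0, h)).filter fun p => m * p.1 + p.2 ^ 2 ≤ 0)
    (by simp [Prod.le_def, hh0, hB0]) ?_
  intro x hx x' hx' hxx' p hp
  have hwin : ∀ a b : ℤ, -B ≤ a → |b| ≤ h → m * a + b ^ 2 ≤ 0 → x (a, b) = x' (a, b) := by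
    intro a b ha hb hab
    refine hxx' _ ?_
    have : a ≤ 0 := by nlinarith [sq_nonneg b]
    simp [Prod.le_def, ha, this, hab, abs_le.1 hb]
  obtain ⟨a, b⟩ := p
  simp only [Finset.mem_filter, Finset.mem_Icc, Prod.le_def] at hp
  obtain ⟨⟨⟨ha, hb⟩, -, hb'⟩, hab⟩ := hp
  simp only [Prod.mk_add_mk, add_zero]
  by_cases hin : m * (a + 1) + b ^ 2 ≤ 0
  · exact hwin _ _ (by omega) (abs_le.2 ⟨hb, hb'⟩) hin
  push Not at hin
  have hba : b ^ 2 ≤ h ^ 2 := sq_le_sq' hb hb'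
  have hah : -(h ^ 2) < a + 1 := by
    by_contra hcon
    nlinarith [sq_nonneg h]
  -- a translate of a coding window fits below the parabola
  have hfit : ∀ w : Z2, |w.1| ≤ D + R → |b + w.2| ≤ h →
      m * (1 + w.1) + 2 * b * w.2 + w.2 ^ 2 ≤ 0 →
      x ((a + 1, b) + w) = x' ((a + 1, b) + w) := by
    rintro ⟨c, d⟩ hc hd hcd
    have := (abs_le.1 hc).1
    exact hwin _ _ (by simp only at this; omega) hd (by simp only at hcd; nlinarith)
  by_cases hlow : 2 * b ≤ -((R + 2) * m)
  · refine hF.apply_eq hX hx hx' _ fun w hw => ?_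
    obtain ⟨h1, h2⟩ := hR w (Finset.mem_union_left _ hw)
    have h3 := (abs_le.1 h1).2
    have h4 := (abs_le.1 h2).2
    rcases hFS hw with hpos | ⟨hz, hneg⟩
    · refine hfit w (by omega) (abs_le.2 ⟨by omega, by linarith⟩) ?_
      have h5 := mul_le_mul_of_nonneg_right hlow hpos.le
      have h6 := mul_le_mul_of_nonneg_left (show 1 ≤ w.2 from hpos) hRm.le
      have h7 := mul_le_mul_of_nonneg_left h3 hm0.le
      have h8 := sq_le_sq' (abs_le.1 h2).1 h4
      linarith [sq_nonneg (D : ℤ)]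
    · refine hfit w (by omega) (by rw [hz, add_zero]; exact abs_le.2 ⟨hb, hb'⟩) ?_
      rw [hz]
      have := mul_nonneg hm0.le (show 0 ≤ -(1 + w.1) by omega)
      linarith
  by_cases hhigh : (R + 2) * m ≤ 2 * b
  · refine hG.apply_eq hX hx hx' _ fun w hw => ?_
    obtain ⟨h1, h2⟩ := hR w (Finset.mem_union_right _ hw)
    have h3 := (abs_le.1 h1).2
    have h4 := (abs_le.1 h2).1
    rcases hGS hw with hpos | ⟨hz, hneg⟩
    · refine hfit w (by omega) (abs_le.2 ⟨by linarith, by omega⟩) ?_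
      have h5 := mul_le_mul_of_nonpos_right hhigh hpos.le
      have h6 := mul_le_mul_of_nonneg_left (show 1 ≤ -w.2 by omega) hRm.le
      have h7 := mul_le_mul_of_nonneg_left h3 hm0.le
      have h8 := sq_le_sq' h4 (abs_le.1 h2).2
      linarith [sq_nonneg (D : ℤ)]
    · refine hfit w (by omega) (by rw [hz, add_zero]; exact abs_le.2 ⟨hb, hb'⟩) ?_
      rw [hz]
      have := mul_nonneg hm0.le (show 0 ≤ -(1 + w.1) by omega)
      linarith
  push Not at hlow hhigh
  have hmR : (0 : ℝ) < m := by exact_mod_cast hm0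
  have hlowR : -(((R : ℝ) + 2) * m) < 2 * b := by exact_mod_cast hlow
  have hhighR : 2 * (b : ℝ) < (R + 2) * m := by exact_mod_cast hhigh
  refine (hD (-(2 * b) / m) ⟨?_, ?_⟩).apply_eq hX hx hx' _ fun w hw => ?_
  · rw [le_div_iff₀ hmR]; linarith
  · rw [div_le_iff₀ hmR]; linarith
  obtain ⟨h1, h2, h3⟩ := hw
  have h4 := abs_le.1 h3
  have h5 : (w.2 : ℝ) ^ 2 ≤ D ^ 2 := sq_le_sq' (by exact_mod_cast h4.1) (by exact_mod_cast h4.2)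
  have h6 : (m : ℝ) = 2 * D ^ 2 + R ^ 2 + 1 := by exact_mod_cast hm
  refine hfit w (by omega) (abs_le.2 ⟨by linarith, by linarith⟩) ?_
  have h7 : (m : ℝ) * w.1 ≤ -(2 * b) * w.2 - 3 / 2 * m := by
    have := mul_le_mul_of_nonneg_left h1 hmR.le
    calc (m : ℝ) * w.1 ≤ m * (-(2 * b) / m * w.2 - 3 / 2) := this
      _ = _ := by field_simp
  have h8 : (m : ℝ) * (1 + w.1) + 2 * b * w.2 + w.2 ^ 2 ≤ 0 := by linarith [sq_nonneg (R : ℝ)]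
  exact_mod_cast h8

end Codes

lemma shiftAct_shiftAct {A : Type*} (u u' : Z2) (x : Config A) :
    shiftAct u (shiftAct u' x) = shiftAct (u' + u) x := by
  funext w
  simp [shiftAct, add_assoc]

/-- Linear coordinates adapted to the lattice basis `(v, w)`, when `crossZ v w = 1`. -/
def latticeCoord (v w p : Z2) : Z2 := (crossZ p w, crossZ v p)

/-- If both orientations of a rational line are closing and every ray to the left of it is
expansive, then the line is a direction of periodicity. -/
lemma exists_period_of_left_expansive {A : Type} [Finite A] {X : Set (Config A)}
    (hX : IsSubshift X) {v : Z2} (hprim : Int.gcd v.1 v.2 = 1)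
    (hcl : ClosingRay X v) (hcl' : ClosingRay X (-v))
    (hside : ∀ u : ℝ × ℝ, u ≠ 0 → 0 < crossR (toR2 v) u → ExpansiveRay X u) :
    ∃ n : ℕ, 0 < n ∧ ∀ x ∈ X, shiftAct ((n : ℤ) • v) x = x := by
  obtain ⟨w, hvw⟩ : ∃ w : Z2, crossZ v w = 1 := by
    refine ⟨(-Int.gcdB v.1 v.2, Int.gcdA v.1 v.2), ?_⟩
    have := Int.gcd_eq_gcd_ab v.1 v.2
    rw [hprim] at this
    simp only [crossZ]
    push_cast at this
    linarith
  obtain ⟨v₁, v₂⟩ := v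
  obtain ⟨w₁, w₂⟩ := w
  simp only [crossZ] at hvw
  have hvwR : (v₁ : ℝ) * w₂ - v₂ * w₁ = 1 := by exact_mod_cast hvw
  set ψ : Z2 → Z2 := latticeCoord (v₁, v₂) (w₁, w₂) with hψ
  set φ : Z2 → Z2 := fun q => q.1 • (v₁, v₂) + q.2 • (w₁, w₂) with hφ
  have hψφ : ∀ q, ψ (φ q) = q := by
    rintro ⟨a, b⟩
    ext
    · simp [hψ, hφ, latticeCoord, crossZ]; linear_combination a * hvw
    · simp [hψ, hφ, latticeCoord, crossZ]; linear_combination b * hvw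
  have hφψ : ∀ q, φ (ψ q) = q := by
    rintro ⟨a, b⟩
    ext
    · simp [hψ, hφ, latticeCoord, crossZ]; linear_combination a * hvw
    · simp [hψ, hφ, latticeCoord, crossZ]; linear_combination b * hvw
  have hψadd : ∀ p q, ψ (p + q) = ψ p + ψ q := by
    rintro ⟨a, b⟩ ⟨c, d⟩
    ext <;> simp [hψ, latticeCoord, crossZ] <;> ring
  have hshift : ∀ u (y : Config A), shiftAct u y ∘ ψ = shiftAct (φ u) (y ∘ ψ) := by
    intro u y
    funext p
    simp [shiftAct, hψadd, hψφ]
  set Y : Set (Config A) := {y | y ∘ ψ ∈ X} with hY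
  have hYsub : IsSubshift Y := by
    refine ⟨?_, fun u y hy => ?_⟩
    · let _ : TopologicalSpace A := ⊥
      have hXc : IsClosed X := hX.1
      exact hXc.preimage (continuous_pi fun p => continuous_apply (ψ p))
    · rw [hY, Set.mem_ofPred_eq, hshift]
      exact hX.2 _ _ hy
  -- transfer of a coding statement based at a translate of the origin
  have transfer : ∀ (S : Set (ℝ × ℝ)) (T : Set (ℝ × ℝ)) (V : Set Z2) (u : Z2),
      Codes X S T → toR2 (φ (-u)) ∈ T → (∀ q, toR2 (φ q) ∈ S → u + q ∈ V) →
      CodesZ Y V {0} := by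
    rintro S T V u hST hT hSV y hy y' hy' hyy' p rfl
    have := hST (shiftAct u y ∘ ψ) (hYsub.2 u y hy) (shiftAct u y' ∘ ψ) (hYsub.2 u y' hy')
      (fun p hp => hyy' _ (hSV (ψ p) (by rwa [hφψ]))) (φ (-u)) hT
    simpa [shiftAct, hψφ] using this
  have hexp : ∀ s : ℝ, CodesZ Y {q | (q.1 : ℝ) ≤ s * q.2 - 2} {0} := by
    intro s
    have hu : crossR (toR2 (v₁, v₂)) (s * v₁ + w₁, s * v₂ + w₂) = 1 := by
      simp only [crossR, toR2]; linear_combination hvwR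
    refine transfer _ _ _ (-2, 0) (hside (s * v₁ + w₁, s * v₂ + w₂) ?_ (by rw [hu]; norm_num))
      (Set.mem_univ _) ?_
    · intro h0
      rw [h0] at hu
      simp [crossR] at hu
    · rintro ⟨a, b⟩ hq
      simp only [leftHalfPlane, toR2, hφ, Set.mem_ofPred_eq] at hq ⊢
      simp at hq ⊢
      have : (s * v₁ + w₁) * ((a : ℝ) * v₂ + b * w₂) - (s * v₂ + w₂) * (a * v₁ + b * w₁)
          = s * b - a := by
        linear_combination (s * b - a) * hvwR
      linarith
  have hup : CodesZ Y {q | 0 < q.2 ∨ (q.2 = 0 ∧ q.1 < 0)} {0} := by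
    obtain ⟨N, hN⟩ := hcl
    have hz : v₁ * (φ (-N, -1)).2 - v₂ * (φ (-N, -1)).1 = -1 := by
      simp [hφ]; linear_combination -hvw
    refine transfer _ _ _ (0, 1) (hN (φ (-N, -1)) hz N le_rfl) ?_ ?_
    · simp [lineL0, toR2, hφ]
      linear_combination -hvwR
    · rintro ⟨a, b⟩ (hq | ⟨k, hk, hq⟩)
      · simp [leftHalfPlane, toR2, hφ] at hq
        have : (v₁ : ℝ) * ((a : ℝ) * v₂ + b * w₂) - v₂ * (a * v₁ + b * w₁) = b := by
          linear_combination b * hvwR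
        have hb' : 0 ≤ (b : ℝ) := by linarith
        have hb : 0 ≤ b := by exact_mod_cast hb'
        left
        simp
        omega
      · have hq' : φ (-N, -1) + (k : ℤ) • (v₁, v₂) = φ (a, b) := by
          simp only [toR2, Prod.mk.injEq, Int.cast_inj] at hq
          exact Prod.ext hq.1 hq.2
        have h2 : φ (-N, -1) + (k : ℤ) • (v₁, v₂) = φ (-N + k, -1) := by
          ext <;> simp [hφ] <;> ring
        rw [h2] at hq'
        have := congrArg ψ hq'
        rw [hψφ, hψφ] at this
        simp only [Prod.mk.injEq] at this
        have hk' : k < N := hk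
        right
        simp
        omega
  have hdown : CodesZ Y {q | q.2 < 0 ∨ (q.2 = 0 ∧ q.1 < 0)} {0} := by
    obtain ⟨N, hN⟩ := hcl'
    have hz : (-(v₁, v₂) : Z2).1 * (φ (-1, 1)).2 - (-(v₁, v₂) : Z2).2 * (φ (-1, 1)).1 = -1 := by
      simp [hφ]; linear_combination -hvw
    refine transfer _ _ _ (0, -1) (hN (φ (-1, 1)) hz N le_rfl) ?_ ?_
    · simp [lineL0, toR2, hφ]
      linear_combination -hvwR
    · rintro ⟨a, b⟩ (hq | ⟨k, hk, hq⟩)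
      · simp only [leftHalfPlane, toR2, hφ, Set.mem_ofPred_eq] at hq
        simp at hq
        have : (v₁ : ℝ) * ((a : ℝ) * v₂ + b * w₂) - v₂ * (a * v₁ + b * w₁) = b := by
          linear_combination b * hvwR
        have hb' : (b : ℝ) ≤ 0 := by linarith
        have hb : b ≤ 0 := by exact_mod_cast hb'
        left
        simp
        omega
      · have hq' : φ (-1, 1) + (k : ℤ) • (-(v₁, v₂)) = φ (a, b) := by
          simp only [toR2, Prod.mk.injEq, Int.cast_inj] at hq
          exact Prod.ext hq.1 hq.2
        have h2 : φ (-1, 1) + (k : ℤ) • (-(v₁, v₂)) = φ (-1 - k, 1) := by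
          ext <;> simp [hφ] <;> ring
        rw [h2] at hq'
        have := congrArg ψ hq'
        rw [hψφ, hψφ] at this
        simp only [Prod.mk.injEq] at this
        right
        simp
        omega
  obtain ⟨n, hn, hper⟩ := exists_horizontal_period hYsub hexp hup hdown
  refine ⟨n, hn, fun x hx => ?_⟩
  have hxY : x ∘ φ ∈ Y := by
    have : (x ∘ φ) ∘ ψ = x := by funext p; simp [hφψ]
    rw [hY, Set.mem_ofPred_eq, this]
    exact hx
  have := congrArg (· ∘ ψ) (hper _ hxY)
  rw [hshift] at this
  have h2 : (x ∘ φ) ∘ ψ = x := by funext p; simp [hφψ]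
  rw [h2] at this
  simpa [hφ] using this

lemma shiftAct_zsmul_eq {A : Type*} {x : Config A} {p : Z2} (h : shiftAct p x = x) (k : ℤ) :
    shiftAct (k • p) x = x := by
  have key : ∀ q, x (p + q) = x q := fun q => congrFun h q
  induction k with
  | zero => funext q; simp [shiftAct]
  | succ k ih =>
    rw [add_smul, one_smul, ← shiftAct_shiftAct, ih, h]
  | pred k ih =>
    funext q
    have h1 := congrFun ih q
    simp only [shiftAct] at h1 ⊢
    rw [← h1, ← key]
    congr 1
    rw [sub_smul, one_smul]
    abel

/-- A common period makes every ray not parallel to it expansive. -/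
lemma expansiveRay_of_period {A : Type*} {X : Set (Config A)} {p : Z2}
    (hp : ∀ x ∈ X, shiftAct p x = x) {u : ℝ × ℝ} (hu : crossR u (toR2 p) ≠ 0) :
    ExpansiveRay X u := by
  intro x hx x' hx' h q _
  obtain ⟨k, hk⟩ : ∃ k : ℤ, 0 ≤ crossR u (toR2 q) + k * crossR u (toR2 p) := by
    rcases lt_or_gt_of_ne hu with hneg | hpos
    · obtain ⟨k, hk⟩ := exists_int_lt (-(crossR u (toR2 q)) / crossR u (toR2 p))
      refine ⟨k, ?_⟩
      rw [lt_div_iff_of_neg hneg] at hk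
      linarith
    · obtain ⟨k, hk⟩ := exists_int_gt (-(crossR u (toR2 q)) / crossR u (toR2 p))
      refine ⟨k, ?_⟩
      rw [div_lt_iff₀ hpos] at hk
      linarith
  have e1 := congrFun (shiftAct_zsmul_eq (hp x hx) k) q
  have e2 := congrFun (shiftAct_zsmul_eq (hp x' hx') k) q
  rw [← e1, ← e2]
  refine h _ ?_
  simp only [crossR, toR2] at hk
  simp [leftHalfPlane, toR2]
  linarith

lemma sameRay_or_of_crossR_eq_zero {u v : ℝ × ℝ} (hv : v ≠ 0) (h : crossR u v = 0) :
    SameRay ℝ u v ∨ SameRay ℝ u (-v) := by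
  obtain ⟨u₁, u₂⟩ := u
  obtain ⟨v₁, v₂⟩ := v
  simp only [crossR] at h
  have hpos : 0 < v₁ ^ 2 + v₂ ^ 2 := by
    by_contra hcon
    have h1 : v₁ = 0 := by nlinarith [sq_nonneg v₁, sq_nonneg v₂]
    have h2 : v₂ = 0 := by nlinarith [sq_nonneg v₁, sq_nonneg v₂]
    exact hv (by rw [h1, h2]; rfl)
  set c := (u₁ * v₁ + u₂ * v₂) / (v₁ ^ 2 + v₂ ^ 2) with hc
  have hu : ((u₁, u₂) : ℝ × ℝ) = c • (v₁, v₂) := by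
    ext
    · simp only [hc, Prod.smul_mk, smul_eq_mul]
      field_simp
      linear_combination v₂ * h
    · simp only [hc, Prod.smul_mk, smul_eq_mul]
      field_simp
      linear_combination -v₁ * h
  rw [hu]
  rcases le_total 0 c with h0 | h0
  · exact Or.inl (SameRay.sameRay_nonneg_smul_left _ h0)
  · right
    rw [← neg_smul_neg]
    exact SameRay.sameRay_nonneg_smul_left _ (neg_nonneg.2 h0)

/-- if `X` has two antiparallel nonexpansive closing rays `ℓ, −ℓ` in a
rational line `L` and one open half plane bounded by `L` contains no nonexpansive
direction, then `ℓ` and `−ℓ` are the only nonexpansive rays and `L` is a periodic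
direction for `X`. -/
theorem statement14 {A : Type} [Fintype A] [Nonempty A] (X : Set (Config A))
    (hX : IsSubshift X) (v : Z2) (hprim : Int.gcd v.1 v.2 = 1)
    (hne : ¬ ExpansiveRay X (toR2 v)) (hne' : ¬ ExpansiveRay X (-toR2 v))
    (hcl : ClosingRay X v) (hcl' : ClosingRay X (-v))
    (hside : (∀ u : ℝ × ℝ, u ≠ 0 → 0 < crossR (toR2 v) u → ExpansiveRay X u) ∨
             (∀ u : ℝ × ℝ, u ≠ 0 → crossR (toR2 v) u < 0 → ExpansiveRay X u)) :
    (∀ u : ℝ × ℝ, u ≠ 0 → ¬ ExpansiveRay X u →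
       SameRay ℝ u (toR2 v) ∨ SameRay ℝ u (-toR2 v)) ∧
    ∃ p : Z2, p ≠ 0 ∧ crossZ v p = 0 ∧ ∀ x ∈ X, shiftAct p x = x := by
  have hv : v ≠ 0 := by
    rintro rfl
    simp at hprim
  obtain ⟨n, hn, hper⟩ : ∃ n : ℕ, 0 < n ∧ ∀ x ∈ X, shiftAct ((n : ℤ) • v) x = x := by
    rcases hside with hside | hside
    · exact exists_period_of_left_expansive hX hprim hcl hcl' hside
    · obtain ⟨n, hn, h⟩ := exists_period_of_left_expansive (v := -v) hX (by simpa using hprim)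
        hcl' (by simpa using hcl) (fun u hu h => hside u hu (by
          simp [crossR, toR2] at h ⊢
          linarith))
      refine ⟨n, hn, fun x hx => ?_⟩
      have := shiftAct_zsmul_eq (h x hx) (-1)
      simpa using this
  have hn0 : (n : ℤ) ≠ 0 := by exact_mod_cast hn.ne'
  refine ⟨fun u _ hue => ?_, (n : ℤ) • v, smul_ne_zero hn0 hv, ?_, hper⟩
  · have hcross : crossR u (toR2 ((n : ℤ) • v)) = 0 :=
      not_not.1 fun hcon => hue (expansiveRay_of_period hper hcon)
    refine sameRay_or_of_crossR_eq_zero ?_ ?_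
    · intro h0
      apply hv
      simp only [toR2, Prod.mk_eq_zero, Int.cast_eq_zero] at h0
      exact Prod.ext h0.1 h0.2
    · have hnR : (n : ℝ) ≠ 0 := by exact_mod_cast hn.ne'
      refine (mul_eq_zero.1 (?_ : (n : ℝ) * _ = 0)).resolve_left hnR
      rw [← hcross]
      simp [crossR, toR2]
      ring
  · simp [crossZ]
    ring

end PolygonalShifts
end
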